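/- arXiv:1612.00736 — 3 statements merged into one kernel-verified Lean document; each statement's English description precedes it below -/
import Mathlib

section
/- Let (W,S) be a Coxeter system of finite rank, let I, J ⊆ S, and let w ∈ W have every element of I as a left ascent and every element of J as a right ascent. Then C = W_I w W_J is the lex-minimal presentation of C if and only if: (a) no connected component of J is contained in (w⁻¹ I w) ∩ S; and (b) whenever a connected component I₀ of I satisfies w⁻¹ I₀ w ⊆ S, then w⁻¹ I₀ w is not contained in J and there is an element of J that is adjacent to or contained in w⁻¹ I₀ w. -/
open CoxeterSystem

variable {B : Type*} {W : Type*} [Group W]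

/-- The standard parabolic subgroup `W_I` of a Coxeter system, generated by the
simple reflections indexed by `I`. -/
def CoxeterSystem.parabolic {M : CoxeterMatrix B} (cs : CoxeterSystem M W) (I : Set B) :
    Subgroup W :=
  Subgroup.closure (cs.simple '' I)

/-- The parabolic double coset `W_I w W_J`. -/
def CoxeterSystem.doubleCoset {M : CoxeterMatrix B} (cs : CoxeterSystem M W) (I : Set B)
    (w : W) (J : Set B) : Set W :=
  {x | ∃ u ∈ cs.parabolic I, ∃ v ∈ cs.parabolic J, x = u * w * v}

/-- Two simple reflections are adjacent in the Coxeter graph if they are distinct and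
do not commute. -/
def CoxeterSystem.adjacent {M : CoxeterMatrix B} (cs : CoxeterSystem M W) (s t : B) : Prop :=
  s ≠ t ∧ cs.simple s * cs.simple t ≠ cs.simple t * cs.simple s

/-- The connected component of `i` in the subgraph of the Coxeter graph induced by `I`. -/
def CoxeterSystem.component {M : CoxeterMatrix B} (cs : CoxeterSystem M W) (I : Set B)
    (i : B) : Set B :=
  {j | Relation.ReflTransGen (fun a b => a ∈ I ∧ b ∈ I ∧ cs.adjacent a b) i j}

/-- `(I, w, J)` is a lex-minimal presentation of the parabolic double coset `W_I w W_J`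
if `w` is the unique minimal-length element of the coset and, among all presentations
of the coset with the same `w`, the pair `(|I|, |J|)` is lexicographically minimal. -/
def CoxeterSystem.IsLexMinimalPresentation {M : CoxeterMatrix B} (cs : CoxeterSystem M W)
    (I : Set B) (w : W) (J : Set B) : Prop :=
  (∀ x ∈ cs.doubleCoset I w J, x ≠ w → cs.length w < cs.length x) ∧
  (∀ I' J' : Set B, cs.doubleCoset I' w J' = cs.doubleCoset I w J →
    I.ncard < I'.ncard ∨ (I.ncard = I'.ncard ∧ J.ncard ≤ J'.ncard))

namespace CoxeterSystem

variable {M : CoxeterMatrix B}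

open Polynomial Module in
theorem chebyshevS_eval_two_mul_cos_mul_sin (n : ℤ) (θ : ℝ) :
    (Chebyshev.S ℝ n).eval (2 * Real.cos θ) * Real.sin θ = Real.sin ((n + 1) * θ) := by
  rw [← Chebyshev.U_real_cos, ← Chebyshev.S_comp_two_mul_X]
  simp

/-- The linear form on `B →₀ ℝ` pairing with the simple root of `i` in the
geometric representation. -/
noncomputable def simpleCoroot (M : CoxeterMatrix B) (i : B) : Module.Dual ℝ (B →₀ ℝ) :=
  Finsupp.linearCombination ℝ fun j => -2 * Real.cos (Real.pi / M i j)

theorem simpleCoroot_single (M : CoxeterMatrix B) (i j : B) :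
    simpleCoroot M i (Finsupp.single j 1) = -2 * Real.cos (Real.pi / M i j) := by
  simp [simpleCoroot]

theorem simpleCoroot_single_self (M : CoxeterMatrix B) (i : B) :
    simpleCoroot M i (Finsupp.single i 1) = 2 := by
  simp [simpleCoroot_single]

/-- The reflection by which a simple generator acts in the geometric representation. -/
noncomputable def simpleReflection (M : CoxeterMatrix B) (i : B) :
    (B →₀ ℝ) ≃ₗ[ℝ] (B →₀ ℝ) :=
  Module.reflection (simpleCoroot_single_self M i)

open Polynomial in
theorem isLiftable_simpleReflection (M : CoxeterMatrix B) :
    M.IsLiftable (simpleReflection M) := by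
  intro i j
  by_cases hij : i = j
  · subst hij
    ext1 v
    simpa [simpleReflection] using Module.involutive_reflection (simpleCoroot_single_self M i) v
  ext1 v
  rw [simpleReflection, simpleReflection, Module.reflection_mul_reflection_pow_apply]
  rw [simpleCoroot_single, simpleCoroot_single, M.symmetric j i]
  have h1 := M.off_diagonal i j hij
  obtain ⟨m, hm⟩ : ∃ m, m = M i j := ⟨_, rfl⟩
  rw [← hm] at h1 ⊢
  rcases Nat.eq_zero_or_pos m with rfl | hpos
  · simp
  by_cases h2 : m = 2
  · subst h2
    generalize Finsupp.single i (1 : ℝ) = x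
    generalize Finsupp.single j (1 : ℝ) = y
    simp
    module
  have h3 : 3 ≤ m := by omega
  set θ : ℝ := 2 * (Real.pi / m) with hθ
  have hm0 : (0 : ℝ) < m := by exact_mod_cast hpos
  have hsin : Real.sin θ ≠ 0 := by
    apply ne_of_gt
    apply Real.sin_pos_of_pos_of_lt_pi
    · positivity
    · rw [hθ, ← mul_div_assoc, div_lt_iff₀ hm0]
      have : (3 : ℝ) ≤ m := by exact_mod_cast h3
      nlinarith [Real.pi_pos]
  have ht : (-2 * Real.cos (Real.pi / m)) * (-2 * Real.cos (Real.pi / m)) - 2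
      = 2 * Real.cos θ := by
    rw [hθ, Real.cos_two_mul]
    ring
  rw [ht]
  have hmθ : (m : ℝ) * θ = 2 * Real.pi := by rw [hθ]; field_simp
  rcases Nat.even_or_odd' m with ⟨k, rfl | rfl⟩
  · have e1 : (((2 * k : ℕ) : ℤ) - 2) / 2 = k - 1 := by omega
    have e2 : (((2 * k : ℕ) : ℤ) - 1) / 2 = k - 1 := by omega
    have hS : (Chebyshev.S ℝ ((k : ℤ) - 1)).eval (2 * Real.cos θ) = 0 := by
      have h := chebyshevS_eval_two_mul_cos_mul_sin ((k : ℤ) - 1) θ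
      have : (((k : ℤ) - 1 : ℤ) + 1 : ℝ) * θ = Real.pi := by
        push_cast at hmθ ⊢
        linarith
      rw [this, Real.sin_pi] at h
      exact (mul_eq_zero.mp h).resolve_right hsin
    rw [e1, e2, hS]
    simp
  · have e1 : (((2 * k + 1 : ℕ) : ℤ) - 2) / 2 = k - 1 := by omega
    have e2 : (((2 * k + 1 : ℕ) : ℤ) - 1) / 2 = k := by omega
    have e3 : (((2 * k + 1 : ℕ) : ℤ) - 3) / 2 = k - 1 := by omega
    have e4 : ((2 * k + 1 : ℕ) : ℤ) / 2 = k := by omega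
    have hS : (Chebyshev.S ℝ (k : ℤ)).eval (2 * Real.cos θ) +
        (Chebyshev.S ℝ ((k : ℤ) - 1)).eval (2 * Real.cos θ) = 0 := by
      have h := chebyshevS_eval_two_mul_cos_mul_sin ((k : ℤ) - 1) θ
      have h' := chebyshevS_eval_two_mul_cos_mul_sin (k : ℤ) θ
      have : (((k : ℤ) : ℝ) + 1) * θ = 2 * Real.pi - ((((k : ℤ) - 1 : ℤ) : ℝ) + 1) * θ := by
        push_cast at hmθ ⊢
        linarith
      rw [this, Real.sin_two_pi_sub] at h'
      have : ((Chebyshev.S ℝ (k : ℤ)).eval (2 * Real.cos θ) +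
        (Chebyshev.S ℝ ((k : ℤ) - 1)).eval (2 * Real.cos θ)) * Real.sin θ = 0 := by
        rw [add_mul, h, h']
        ring
      exact (mul_eq_zero.mp this).resolve_right hsin
    rw [e1, e2, e3, e4, hS]
    simp

theorem simple_injective (cs : CoxeterSystem M W) : Function.Injective cs.simple := by
  intro i j h
  have h' : simpleReflection M i = simpleReflection M j := by
    rw [← cs.lift_apply_simple (isLiftable_simpleReflection M), h, cs.lift_apply_simple]
  have h1 : simpleReflection M i (Finsupp.single i 1) = -Finsupp.single i 1 := by
    simp [simpleReflection]
  rw [h', simpleReflection, Module.reflection_apply] at h1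
  by_contra hij
  have := DFunLike.congr_fun h1 i
  rw [Finsupp.sub_apply, Finsupp.smul_apply, Finsupp.neg_apply, Finsupp.single_eq_same,
    Finsupp.single_eq_of_ne hij] at this
  norm_num at this

/-- The generator of the permutation action of the Coxeter group on signed group elements. -/
def signedConj [DecidableEq W] (cs : CoxeterSystem M W) (i : B) : Function.End (W × ZMod 2) :=
  fun p => (cs.simple i * p.1 * cs.simple i, p.2 + if p.1 = cs.simple i then 1 else 0)

theorem signedConj_mul_pow_apply [DecidableEq W] (cs : CoxeterSystem M W) (i j : B) (k : ℕ)
    (t : W) (ε : ZMod 2) :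
    ((cs.signedConj i * cs.signedConj j) ^ k) (t, ε) =
      ((cs.simple i * cs.simple j) ^ k * t * ((cs.simple i * cs.simple j) ^ k)⁻¹,
        ε + ∑ l ∈ Finset.range (2 * k),
          if t = cs.simple j * (cs.simple i * cs.simple j) ^ l then 1 else 0) := by
  induction k with
  | zero => simp; rfl
  | succ k ih =>
    have key : ∀ l : ℕ, ((cs.simple i * cs.simple j) ^ l)⁻¹ * cs.simple j =
        cs.simple j * (cs.simple i * cs.simple j) ^ l := by
      intro l
      rw [← inv_pow, mul_inv_rev, inv_simple, inv_simple]
      have h := (SemiconjBy.pow_right (a := cs.simple j) (x := cs.simple i * cs.simple j)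
        (y := cs.simple j * cs.simple i) (by simp [SemiconjBy, mul_assoc]) l)
      exact h.eq.symm
    set r := cs.simple i * cs.simple j with hr
    have c1 : (r ^ k * t * (r ^ k)⁻¹ = cs.simple j) ↔ t = cs.simple j * r ^ (2 * k) := by
      rw [mul_inv_eq_iff_eq_mul, ← eq_inv_mul_iff_mul_eq, ← mul_assoc, key, mul_assoc, two_mul,
        pow_add]
    have c2 : (cs.simple j * (r ^ k * t * (r ^ k)⁻¹) * cs.simple j = cs.simple i) ↔
        t = cs.simple j * r ^ (2 * k + 1) := by
      have : cs.simple j * cs.simple i * cs.simple j = cs.simple j * r := by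
        rw [hr, mul_assoc]
      rw [← eq_mul_inv_iff_mul_eq, inv_simple, ← eq_inv_mul_iff_mul_eq, inv_simple, ← mul_assoc,
        this, mul_inv_eq_iff_eq_mul, ← eq_inv_mul_iff_mul_eq, mul_assoc, ← mul_assoc, key,
        mul_assoc, ← pow_succ', ← pow_add]
      congr! 3
      omega
    rw [pow_succ' (cs.signedConj i * cs.signedConj j)]
    change cs.signedConj i (cs.signedConj j (((cs.signedConj i * cs.signedConj j) ^ k) (t, ε))) = _
    rw [ih, signedConj, signedConj]
    refine Prod.ext ?_ ?_
    · simp [pow_succ', hr, mul_assoc]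
    · simp only [c1, c2]
      rw [show 2 * (k + 1) = 2 * k + 1 + 1 by ring, Finset.sum_range_succ, Finset.sum_range_succ]
      ring

theorem isLiftable_signedConj [DecidableEq W] (cs : CoxeterSystem M W) :
    M.IsLiftable cs.signedConj := by
  intro i j
  funext ⟨t, ε⟩
  rw [signedConj_mul_pow_apply, two_mul, Finset.sum_range_add]
  simp only [pow_add, simple_mul_simple_pow, one_mul]
  rw [CharTwo.add_self_eq_zero]
  simp
  rfl

theorem lift_signedConj_wordProd_apply [DecidableEq W] (cs : CoxeterSystem M W) (ω : List B)
    (t : W) (ε : ZMod 2) :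
    cs.lift ⟨cs.signedConj, cs.isLiftable_signedConj⟩ (cs.wordProd ω) (t, ε) =
      (cs.wordProd ω * t * (cs.wordProd ω)⁻¹, ε + (cs.rightInvSeq ω).count t) := by
  induction ω with
  | nil => simp; rfl
  | cons i ω ih =>
    rw [wordProd_cons, map_mul]
    change cs.lift ⟨cs.signedConj, cs.isLiftable_signedConj⟩ (cs.simple i)
      (cs.lift ⟨cs.signedConj, cs.isLiftable_signedConj⟩ (cs.wordProd ω) (t, ε)) = _
    rw [ih, cs.lift_apply_simple, signedConj, rightInvSeq, List.count_cons]
    refine Prod.ext ?_ ?_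
    · simp [mul_assoc]
    · have : (cs.wordProd ω * t * (cs.wordProd ω)⁻¹ = cs.simple i) ↔
          ((cs.wordProd ω)⁻¹ * cs.simple i * cs.wordProd ω == t) = true := by
        rw [beq_iff_eq, mul_inv_eq_iff_eq_mul, ← eq_inv_mul_iff_mul_eq, mul_assoc, eq_comm]
      simp only [this]
      push_cast
      ring

/-- The exchange property for right multiplication by a simple reflection. -/
theorem exists_mul_simple_eq_wordProd_eraseIdx (cs : CoxeterSystem M W) (ω : List B) (i : B)
    (h : cs.length (cs.wordProd ω * cs.simple i) < cs.length (cs.wordProd ω)) :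
    ∃ k < ω.length, cs.wordProd ω * cs.simple i = cs.wordProd (ω.eraseIdx k) := by
  classical
  obtain ⟨ω', hω', hw⟩ := cs.exists_isReduced (cs.wordProd ω * cs.simple i)
  have h1 : cs.simple i ∉ cs.rightInvSeq ω' := by
    intro hmem
    have := (cs.isRightInversion_of_mem_rightInvSeq hω' hmem).2
    rw [← hw, simple_mul_simple_cancel_right] at this
    omega
  have h2 : cs.wordProd ω = cs.wordProd (ω' ++ [i]) := by
    rw [wordProd_append, ← hw, wordProd_singleton, simple_mul_simple_cancel_right]
  have h3 := congrArg Prod.snd (cs.lift_signedConj_wordProd_apply ω (cs.simple i) 0)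
  rw [h2, cs.lift_signedConj_wordProd_apply] at h3
  have h4 : cs.simple i ∈ cs.rightInvSeq ω := by
    rw [← List.count_pos_iff, Nat.pos_iff_ne_zero]
    intro h0
    have hnot : cs.simple i ∉ (cs.rightInvSeq ω').map (MulAut.conj (cs.simple i)) := by
      rw [List.mem_map]
      rintro ⟨x, hx, hxe⟩
      have : x = cs.simple i := by
        rw [MulAut.conj_apply, mul_inv_eq_iff_eq_mul] at hxe
        exact mul_left_cancel hxe
      exact h1 (this ▸ hx)
    rw [← List.concat_eq_append, rightInvSeq_concat,
      List.concat_eq_append (as := List.map _ _), List.count_append,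
      List.count_eq_zero_of_not_mem hnot, h0] at h3
    simp at h3
  obtain ⟨k, hk, hke⟩ := List.mem_iff_getElem.mp h4
  refine ⟨k, by simpa using hk, ?_⟩
  rw [← wordProd_mul_getD_rightInvSeq, List.getD_eq_getElem _ _ hk, hke]

/-- The exchange property for left multiplication by a simple reflection. -/
theorem exists_simple_mul_eq_wordProd_eraseIdx (cs : CoxeterSystem M W) (ω : List B) (i : B)
    (h : cs.length (cs.simple i * cs.wordProd ω) < cs.length (cs.wordProd ω)) :
    ∃ k < ω.length, cs.simple i * cs.wordProd ω = cs.wordProd (ω.eraseIdx k) := by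
  have h' : cs.length (cs.wordProd ω.reverse * cs.simple i) < cs.length (cs.wordProd ω.reverse) := by
    rw [← length_inv, ← cs.length_inv (cs.wordProd ω.reverse)]
    simpa using h
  obtain ⟨k, hk, hke⟩ := cs.exists_mul_simple_eq_wordProd_eraseIdx _ _ h'
  rw [List.length_reverse] at hk
  refine ⟨ω.length - 1 - k, by omega, ?_⟩
  have := congrArg (·⁻¹) hke
  simp only [wordProd_reverse, mul_inv_rev, inv_inv, inv_simple] at this
  rw [this, ← wordProd_reverse]
  congr 1
  simp only [List.eraseIdx_eq_take_drop_succ, List.reverse_append, List.take_reverse,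
    List.drop_reverse, List.reverse_reverse]
  congr 2 <;> omega

theorem mem_parabolic_iff (cs : CoxeterSystem M W) {I : Set B} {u : W} :
    u ∈ cs.parabolic I ↔ ∃ ω : List B, (∀ i ∈ ω, i ∈ I) ∧ u = cs.wordProd ω := by
  constructor
  · intro hu
    refine Subgroup.closure_induction (p := fun u _ => ∃ ω : List B, (∀ i ∈ ω, i ∈ I) ∧
      u = cs.wordProd ω) ?_ ?_ ?_ ?_ hu
    · rintro _ ⟨i, hi, rfl⟩
      exact ⟨[i], by simpa using hi, by simp⟩
    · exact ⟨[], by simp, by simp⟩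
    · rintro _ _ _ _ ⟨ω₁, h₁, rfl⟩ ⟨ω₂, h₂, rfl⟩
      refine ⟨ω₁ ++ ω₂, fun i hi => ?_, by rw [wordProd_append]⟩
      exact (List.mem_append.mp hi).elim (h₁ i) (h₂ i)
    · rintro _ _ ⟨ω, h, rfl⟩
      exact ⟨ω.reverse, fun i hi => h i (List.mem_reverse.mp hi), by rw [wordProd_reverse]⟩
  · rintro ⟨ω, h, rfl⟩
    refine Subgroup.list_prod_mem _ fun x hx => ?_
    obtain ⟨i, hi, rfl⟩ := List.mem_map.mp hx
    exact Subgroup.subset_closure ⟨i, h i hi, rfl⟩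

theorem simple_mem_parabolic (cs : CoxeterSystem M W) {I : Set B} {i : B} (hi : i ∈ I) :
    cs.simple i ∈ cs.parabolic I :=
  Subgroup.subset_closure ⟨i, hi, rfl⟩

theorem wordProd_mem_parabolic (cs : CoxeterSystem M W) {I : Set B} {ω : List B}
    (h : ∀ i ∈ ω, i ∈ I) : cs.wordProd ω ∈ cs.parabolic I :=
  cs.mem_parabolic_iff.mpr ⟨ω, h, rfl⟩

theorem parabolic_mono (cs : CoxeterSystem M W) {I J : Set B} (h : I ⊆ J) :
    cs.parabolic I ≤ cs.parabolic J :=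
  Subgroup.closure_mono (Set.image_mono h)

theorem exists_isReduced_of_mem_parabolic (cs : CoxeterSystem M W) {I : Set B} {u : W}
    (hu : u ∈ cs.parabolic I) :
    ∃ ω : List B, cs.IsReduced ω ∧ (∀ i ∈ ω, i ∈ I) ∧ u = cs.wordProd ω := by
  obtain ⟨ω, hω, rfl⟩ := cs.mem_parabolic_iff.mp hu
  clear hu
  induction ω with
  | nil => exact ⟨[], by simp [IsReduced], by simp, rfl⟩
  | cons i ω ih =>
    obtain ⟨ω', hr, hI, he⟩ := ih fun j hj => hω j (List.mem_cons_of_mem _ hj)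
    have hi := hω i List.mem_cons_self
    rcases cs.length_simple_mul (cs.wordProd ω') i with hl | hl
    · refine ⟨i :: ω', ?_, ?_, by rw [wordProd_cons, wordProd_cons, he]⟩
      · rw [IsReduced, wordProd_cons, hl, hr.eq, List.length_cons]
      · simpa using ⟨hi, hI⟩
    · obtain ⟨k, hk, hke⟩ := cs.exists_simple_mul_eq_wordProd_eraseIdx ω' i (by omega)
      refine ⟨ω'.eraseIdx k, ?_, fun j hj => hI j (List.mem_of_mem_eraseIdx hj), ?_⟩
      · have := List.length_eraseIdx_add_one hk
        rw [hke, hr.eq] at hl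
        rw [IsReduced]
        omega
      · rw [wordProd_cons, he, hke]

theorem exists_left_descent_mem_of_mem_parabolic (cs : CoxeterSystem M W) {I : Set B} {u : W}
    (hu : u ∈ cs.parabolic I) (h1 : u ≠ 1) :
    ∃ i ∈ I, cs.length (cs.simple i * u) < cs.length u := by
  obtain ⟨ω, hr, hI, rfl⟩ := cs.exists_isReduced_of_mem_parabolic hu
  cases ω with
  | nil => simp at h1
  | cons i ω =>
    refine ⟨i, hI i List.mem_cons_self, ?_⟩
    rw [hr.eq, wordProd_cons, simple_mul_simple_cancel_left, List.length_cons]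
    exact Nat.lt_succ_of_le (cs.length_wordProd_le ω)

theorem exists_right_descent_mem_of_mem_parabolic (cs : CoxeterSystem M W) {I : Set B} {u : W}
    (hu : u ∈ cs.parabolic I) (h1 : u ≠ 1) :
    ∃ i ∈ I, cs.length (u * cs.simple i) < cs.length u := by
  obtain ⟨i, hi, h⟩ := cs.exists_left_descent_mem_of_mem_parabolic (inv_mem hu) (by simpa using h1)
  refine ⟨i, hi, ?_⟩
  rwa [← length_inv, length_inv, ← cs.length_inv (cs.simple i * u⁻¹), mul_inv_rev, inv_inv,
    inv_simple, cs.length_inv u] at h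

theorem exists_eq_simple_of_mem_parabolic (cs : CoxeterSystem M W) {I : Set B} {u : W}
    (hu : u ∈ cs.parabolic I) (h : cs.length u = 1) : ∃ i ∈ I, u = cs.simple i := by
  obtain ⟨ω, hr, hI, rfl⟩ := cs.exists_isReduced_of_mem_parabolic hu
  rw [hr.eq, List.length_eq_one_iff] at h
  obtain ⟨i, rfl⟩ := h
  exact ⟨i, hI i (by simp), by simp⟩

theorem simple_mem_parabolic_iff (cs : CoxeterSystem M W) {I : Set B} {i : B} :
    cs.simple i ∈ cs.parabolic I ↔ i ∈ I := by
  refine ⟨fun h => ?_, cs.simple_mem_parabolic⟩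
  obtain ⟨j, hj, he⟩ := cs.exists_eq_simple_of_mem_parabolic h (cs.length_simple i)
  exact cs.simple_injective he ▸ hj

theorem length_simple_mul_of_mem_parabolic (cs : CoxeterSystem M W) {L : Set B} {p : B} {z : W}
    (hp : p ∉ L) (hz : z ∈ cs.parabolic L) :
    cs.length (cs.simple p * z) = cs.length z + 1 := by
  refine (cs.length_simple_mul z p).resolve_right fun h => hp ?_
  obtain ⟨ω, hr, hI, rfl⟩ := cs.exists_isReduced_of_mem_parabolic hz
  obtain ⟨k, -, hke⟩ := cs.exists_simple_mul_eq_wordProd_eraseIdx ω p (by omega)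
  rw [← cs.simple_mem_parabolic_iff, eq_mul_inv_of_mul_eq hke]
  exact mul_mem (cs.wordProd_mem_parabolic fun j hj => hI j (List.mem_of_mem_eraseIdx hj))
    (inv_mem hz)

theorem length_mul_of_forall_length_le (cs : CoxeterSystem M W) {I : Set B} {x : W}
    (hx : ∀ u ∈ cs.parabolic I, cs.length x ≤ cs.length (u * x)) {u : W}
    (hu : u ∈ cs.parabolic I) : cs.length (u * x) = cs.length u + cs.length x := by
  obtain ⟨ω, hr, hI, rfl⟩ := cs.exists_isReduced_of_mem_parabolic hu
  rw [hr.eq]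
  clear hu
  induction ω with
  | nil => simp
  | cons i ω ih =>
    have hrω : cs.IsReduced ω := by simpa using hr.drop 1
    have hIω : ∀ j ∈ ω, j ∈ I := fun j hj => hI j (List.mem_cons_of_mem _ hj)
    have hi : i ∈ I := hI i List.mem_cons_self
    specialize ih hrω hIω
    rw [wordProd_cons, mul_assoc]
    rcases cs.length_simple_mul (cs.wordProd ω * x) i with hl | hl
    · rw [hl, ih, List.length_cons]
      ring
    exfalso
    obtain ⟨ξ, hξ, rfl⟩ := cs.exists_isReduced x
    rw [← wordProd_append] at hl
    obtain ⟨k, hk, hke⟩ := cs.exists_simple_mul_eq_wordProd_eraseIdx (ω ++ ξ) i (by omega)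
    rcases lt_or_ge k ω.length with hkω | hkω
    · rw [List.eraseIdx_append_of_lt_length hkω, wordProd_append, wordProd_append, ← mul_assoc,
        mul_left_inj] at hke
      have h1 := hr.eq
      rw [wordProd_cons, hke] at h1
      have h2 := cs.length_wordProd_le (ω.eraseIdx k)
      have h3 := List.length_eraseIdx_add_one hkω
      rw [List.length_cons] at h1
      omega
    · rw [List.eraseIdx_append_of_length_le hkω, wordProd_append, wordProd_append] at hke
      have hkξ : k - ω.length < ξ.length := by
        rw [List.length_append] at hk
        omega
      have h1 := hx ((cs.wordProd ω)⁻¹ * (cs.simple i * cs.wordProd ω))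
        (mul_mem (inv_mem (cs.wordProd_mem_parabolic hIω))
          (mul_mem (cs.simple_mem_parabolic hi) (cs.wordProd_mem_parabolic hIω)))
      rw [mul_assoc, mul_assoc, hke, inv_mul_cancel_left, hξ.eq] at h1
      have h2 := cs.length_wordProd_le (ξ.eraseIdx (k - ω.length))
      have h3 := List.length_eraseIdx_add_one hkξ
      omega

theorem length_parabolic_mul (cs : CoxeterSystem M W) {I : Set B} {w : W}
    (hI : ∀ s ∈ I, cs.length w < cs.length (cs.simple s * w)) {u : W}
    (hu : u ∈ cs.parabolic I) : cs.length (u * w) = cs.length u + cs.length w := by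
  obtain ⟨x, ⟨y, hy, rfl⟩, hmin⟩ := WellFounded.has_min
    (InvImage.wf cs.length Nat.lt_wfRel.wf) {x | ∃ y ∈ cs.parabolic I, x = y * w}
    ⟨w, 1, one_mem _, by simp⟩
  have hadd : ∀ u ∈ cs.parabolic I, cs.length (u * (y * w)) = cs.length u + cs.length (y * w) := by
    refine fun u hu => cs.length_mul_of_forall_length_le (fun v hv => ?_) hu
    exact not_lt.mp (hmin (v * (y * w)) ⟨v * y, mul_mem hv hy, by rw [mul_assoc]⟩)
  have hy1 : y⁻¹ = 1 := by
    by_contra hne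
    obtain ⟨i, hi, hlt⟩ := cs.exists_left_descent_mem_of_mem_parabolic (inv_mem hy) hne
    have h1 := hadd _ (inv_mem hy)
    have h2 := hadd _ (mul_mem (cs.simple_mem_parabolic hi) (inv_mem hy))
    rw [inv_mul_cancel_left] at h1
    rw [mul_assoc, inv_mul_cancel_left] at h2
    have := hI i hi
    omega
  rw [inv_eq_one] at hy1
  simpa [hy1] using hadd u hu

theorem length_inv_mul_inv (cs : CoxeterSystem M W) (x y : W) :
    cs.length (x⁻¹ * y⁻¹) = cs.length (y * x) := by
  rw [← mul_inv_rev, length_inv]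

theorem length_mul_parabolic (cs : CoxeterSystem M W) {J : Set B} {w : W}
    (hJ : ∀ s ∈ J, cs.length w < cs.length (w * cs.simple s)) {v : W}
    (hv : v ∈ cs.parabolic J) : cs.length (w * v) = cs.length w + cs.length v := by
  have h := cs.length_parabolic_mul (w := w⁻¹) (fun s hs => ?_) (inv_mem hv)
  · rw [length_inv_mul_inv, length_inv, length_inv] at h
    omega
  · rw [← inv_simple, length_inv_mul_inv, length_inv]
    exact hJ s hs

/-- If `s` is a left ascent and `t` a right ascent of `w` and `t` is a right descent of `s w`,
then `s w = w t`. -/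
theorem simple_mul_eq_mul_simple_of_length_lt (cs : CoxeterSystem M W) {w : W} {s t : B}
    (ht : cs.length w < cs.length (w * cs.simple t))
    (h : cs.length (cs.simple s * w * cs.simple t) < cs.length (cs.simple s * w)) :
    cs.simple s * w = w * cs.simple t := by
  obtain ⟨ω, hr, rfl⟩ := cs.exists_isReduced w
  rw [← wordProd_cons] at h ⊢
  obtain ⟨k, hk, hke⟩ := cs.exists_mul_simple_eq_wordProd_eraseIdx _ _ h
  cases k with
  | zero =>
    rw [List.eraseIdx_cons_zero] at hke
    rw [← hke, simple_mul_simple_cancel_right]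
  | succ k =>
    rw [List.eraseIdx_cons_succ, wordProd_cons, wordProd_cons, mul_assoc, mul_right_inj] at hke
    have h1 := cs.length_wordProd_le (ω.eraseIdx k)
    have h2 := List.length_eraseIdx_add_one (l := ω) (i := k) (by simpa using hk)
    rw [hke, hr.eq] at ht
    omega

/-- Deodhar's lemma. -/
theorem left_ascents_mul_simple_or (cs : CoxeterSystem M W) {I : Set B} {y : W}
    (hI : ∀ s ∈ I, cs.length y < cs.length (cs.simple s * y)) (t : B) :
    (∀ s ∈ I, cs.length (y * cs.simple t) < cs.length (cs.simple s * (y * cs.simple t))) ∨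
      ∃ s ∈ I, cs.simple s * y = y * cs.simple t := by
  by_contra! hcon
  obtain ⟨⟨s, hs, hle⟩, hne⟩ := hcon
  have h1 := cs.length_simple_mul y s
  have h2 := cs.length_simple_mul (y * cs.simple t) s
  have h3 := cs.length_mul_simple y t
  have h4 := cs.length_mul_simple (cs.simple s * y) t
  have h5 := hI s hs
  rw [mul_assoc] at h4
  refine hne s hs (cs.simple_mul_eq_mul_simple_of_length_lt ?_ ?_)
  · omega
  · rw [mul_assoc]
    omega

theorem exists_length_add_of_mem_doubleCoset (cs : CoxeterSystem M W) {I J : Set B} {w : W}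
    (hI : ∀ s ∈ I, cs.length w < cs.length (cs.simple s * w))
    (hJ : ∀ s ∈ J, cs.length w < cs.length (w * cs.simple s)) {x : W}
    (hx : x ∈ cs.doubleCoset I w J) :
    ∃ u ∈ cs.parabolic I, ∃ v ∈ cs.parabolic J, x = u * w * v ∧
      cs.length x = cs.length u + cs.length w + cs.length v := by
  obtain ⟨u, hu, v, hv, rfl⟩ := hx
  suffices ∃ u' ∈ cs.parabolic I, ∃ v' ∈ cs.parabolic J, u * w * v = u' * (w * v') ∧
      ∀ s ∈ I, cs.length (w * v') < cs.length (cs.simple s * (w * v')) by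
    obtain ⟨u', hu', v', hv', he, hasc⟩ := this
    refine ⟨u', hu', v', hv', by rw [he, mul_assoc], ?_⟩
    rw [he, cs.length_parabolic_mul hasc hu', cs.length_mul_parabolic hJ hv', add_assoc]
  obtain ⟨ω, hω, rfl⟩ := cs.mem_parabolic_iff.mp hv
  clear hv
  induction ω using List.reverseRecOn with
  | nil => exact ⟨u, hu, 1, one_mem _, by simp, by simpa using hI⟩
  | append_singleton ω t ih =>
    obtain ⟨u', hu', v', hv', he, hasc⟩ := ih fun i hi => hω i (List.mem_append_left _ hi)
    have ht : t ∈ J := hω t (by simp)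
    have he' : u * w * cs.wordProd (ω ++ [t]) = u' * (w * v' * cs.simple t) := by
      rw [wordProd_append, wordProd_singleton, ← mul_assoc, he, mul_assoc]
    rw [he']
    rcases cs.left_ascents_mul_simple_or hasc t with h | ⟨s, hs, h⟩
    · refine ⟨u', hu', v' * cs.simple t, mul_mem hv' (cs.simple_mem_parabolic ht), ?_, ?_⟩
      · simp only [mul_assoc]
      · simpa only [mul_assoc] using h
    · refine ⟨u' * cs.simple s, mul_mem hu' (cs.simple_mem_parabolic hs), v', hv', ?_, hasc⟩
      rw [← h, mul_assoc]

/-- A double coset representative without descents in the two parabolic subgroups is the unique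
element of minimal length. -/
theorem length_lt_of_mem_doubleCoset (cs : CoxeterSystem M W) {I J : Set B} {w : W}
    (hI : ∀ s ∈ I, cs.length w < cs.length (cs.simple s * w))
    (hJ : ∀ s ∈ J, cs.length w < cs.length (w * cs.simple s)) {x : W}
    (hx : x ∈ cs.doubleCoset I w J) (hne : x ≠ w) : cs.length w < cs.length x := by
  obtain ⟨u, hu, v, hv, rfl, hl⟩ := cs.exists_length_add_of_mem_doubleCoset hI hJ hx
  by_contra hle
  have hu1 : u = 1 := cs.length_eq_zero_iff.mp (by omega)
  have hv1 : v = 1 := cs.length_eq_zero_iff.mp (by omega)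
  simp [hu1, hv1] at hne

theorem adjacent_symm (cs : CoxeterSystem M W) {s t : B} (h : cs.adjacent s t) :
    cs.adjacent t s :=
  ⟨h.1.symm, h.2.symm⟩

theorem commute_of_not_adjacent (cs : CoxeterSystem M W) {s t : B} (h : ¬ cs.adjacent s t) :
    Commute (cs.simple s) (cs.simple t) := by
  by_cases hst : s = t
  · rw [hst]
  · exact not_not.mp fun hc => h ⟨hst, hc⟩

/-- The product along a path in the Coxeter graph has at most one left descent, namely the first
vertex of the path. -/
theorem head?_eq_of_length_lt_of_isChain (cs : CoxeterSystem M W) {p : List B}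
    (hc : p.IsChain cs.adjacent) (hn : p.Nodup) {a : B}
    (h : cs.length (cs.simple a * cs.wordProd p) < cs.length (cs.wordProd p)) :
    p.head? = some a := by
  induction p generalizing a with
  | nil => simp at h
  | cons b p ih =>
    rw [List.head?_cons, Option.some_inj]
    by_contra hab
    rw [List.nodup_cons] at hn
    have hmem : ∀ i ∈ p, i ∈ {i | i ∈ p} := fun i hi => hi
    have hb : b ∉ {i | i ∈ p} := hn.1
    obtain ⟨k, hk, hke⟩ := cs.exists_simple_mul_eq_wordProd_eraseIdx _ _ h
    rw [wordProd_cons] at hke h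
    cases k with
    | zero =>
      rw [List.eraseIdx_cons_zero, ← mul_assoc, mul_eq_right, mul_eq_one_iff_eq_inv,
        inv_simple] at hke
      exact hab (cs.simple_injective hke).symm
    | succ k =>
      rw [List.eraseIdx_cons_succ, wordProd_cons] at hke
      have hz : cs.wordProd (p.eraseIdx k) * (cs.wordProd p)⁻¹ ∈ cs.parabolic {i | i ∈ p} :=
        mul_mem (cs.wordProd_mem_parabolic fun i hi => hmem i (List.mem_of_mem_eraseIdx hi))
          (inv_mem (cs.wordProd_mem_parabolic hmem))
      have hab' : cs.simple a * cs.simple b =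
          cs.simple b * (cs.wordProd (p.eraseIdx k) * (cs.wordProd p)⁻¹) := by
        rw [← mul_assoc, ← hke]
        simp [mul_assoc]
      have hlen := cs.length_simple_mul_of_mem_parabolic hb hz
      rw [← hab', cs.length_simple_mul_of_mem_parabolic (L := {b}) (p := a) (by
        simpa using fun h => hab h.symm) (cs.simple_mem_parabolic rfl), length_simple] at hlen
      obtain ⟨c, hc', hce⟩ := cs.exists_eq_simple_of_mem_parabolic hz (by omega)
      rw [hce] at hab'
      have hac : a = c := by
        have : cs.simple a ∈ cs.parabolic {b, c} := by
          rw [eq_mul_inv_of_mul_eq hab', inv_simple]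
          exact mul_mem (mul_mem (cs.simple_mem_parabolic (by simp))
            (cs.simple_mem_parabolic (by simp))) (cs.simple_mem_parabolic (by simp))
        rw [cs.simple_mem_parabolic_iff] at this
        exact this.resolve_left fun h => hab h.symm
      subst hac
      rw [← mul_assoc, hab', mul_assoc, cs.length_simple_mul_of_mem_parabolic hb
        (mul_mem (cs.simple_mem_parabolic hc') (cs.wordProd_mem_parabolic hmem)),
        cs.length_simple_mul_of_mem_parabolic hb (cs.wordProd_mem_parabolic hmem)] at h
      have hhead := ih hc.of_cons hn.2 (a := a) (by omega)
      cases p with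
      | nil => simp at hhead
      | cons d p =>
        rw [List.head?_cons, Option.some_inj] at hhead
        subst hhead
        rw [List.isChain_cons_cons] at hc
        exact hc.1.2 hab'.symm

theorem getLast?_eq_of_length_lt_of_isChain (cs : CoxeterSystem M W) {p : List B}
    (hc : p.IsChain cs.adjacent) (hn : p.Nodup) {a : B}
    (h : cs.length (cs.wordProd p * cs.simple a) < cs.length (cs.wordProd p)) :
    p.getLast? = some a := by
  rw [← List.head?_reverse]
  refine cs.head?_eq_of_length_lt_of_isChain ?_ (List.nodup_reverse.mpr hn) ?_
  · rw [List.isChain_reverse]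
    exact hc.imp fun _ _ => cs.adjacent_symm
  · rw [wordProd_reverse, length_inv, ← inv_simple, length_inv_mul_inv]
    exact h

/-- Let `a, …, b` be a path in the Coxeter graph consisting of left ascents of `w`. If the product
`a ⋯ b w` lies in `W_I w W_J`, then `a ∈ I` or `w⁻¹ b w ∈ J`. -/
theorem head_mem_or_of_wordProd_mul_mem_doubleCoset (cs : CoxeterSystem M W) {I J : Set B} {w : W}
    (hI : ∀ s ∈ I, cs.length w < cs.length (cs.simple s * w))
    (hJ : ∀ s ∈ J, cs.length w < cs.length (w * cs.simple s)) {p : List B}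
    (hc : p.IsChain cs.adjacent) (hn : p.Nodup)
    (hp : ∀ s ∈ p, cs.length w < cs.length (cs.simple s * w))
    (hmem : cs.wordProd p * w ∈ cs.doubleCoset I w J) {a b : B} (ha : p.head? = some a)
    (hb : p.getLast? = some b) :
    a ∈ I ∨ ∃ t ∈ J, cs.simple b * w = w * cs.simple t := by
  obtain ⟨u, hu, v, hv, he, hl⟩ := cs.exists_length_add_of_mem_doubleCoset hI hJ hmem
  have hpp : cs.wordProd p ∈ cs.parabolic {i | i ∈ p} := cs.wordProd_mem_parabolic fun i hi => hi
  by_cases hv1 : v = 1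
  · left
    rw [hv1, mul_one, mul_left_inj] at he
    have hne : u ≠ 1 := by
      rw [← he]
      cases p with
      | nil => simp at ha
      | cons c p =>
        rw [wordProd_cons, Ne, ← cs.length_eq_zero_iff,
          cs.length_simple_mul_of_mem_parabolic (L := {i | i ∈ p}) (List.nodup_cons.mp hn).1
            (cs.wordProd_mem_parabolic fun i hi => hi)]
        omega
    obtain ⟨i, hi, hlt⟩ := cs.exists_left_descent_mem_of_mem_parabolic hu hne
    rw [← he] at hlt
    have := cs.head?_eq_of_length_lt_of_isChain hc hn hlt
    rw [ha, Option.some_inj] at this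
    exact this ▸ hi
  · right
    obtain ⟨t, ht, hlt⟩ := cs.exists_right_descent_mem_of_mem_parabolic hv hv1
    have hlt' : cs.length (cs.wordProd p * w * cs.simple t) < cs.length (cs.wordProd p * w) := by
      rw [hl, he, mul_assoc (u * w)]
      have h1 := cs.length_mul_le (u * w) (v * cs.simple t)
      have h2 := cs.length_mul_le u w
      omega
    refine ⟨t, ht, ?_⟩
    rcases cs.left_ascents_mul_simple_or (I := {i | i ∈ p}) hp t with h | ⟨c, hcp, h⟩
    · rw [mul_assoc, cs.length_parabolic_mul h hpp, cs.length_parabolic_mul hp hpp] at hlt'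
      have := hJ t ht
      omega
    · rw [mul_assoc, ← h, ← mul_assoc, cs.length_parabolic_mul hp hpp,
        cs.length_parabolic_mul hp (mul_mem hpp (cs.simple_mem_parabolic hcp))] at hlt'
      have := cs.getLast?_eq_of_length_lt_of_isChain hc hn (a := c) (by omega)
      rw [hb, Option.some_inj] at this
      rw [this, h]

theorem inv_mem_doubleCoset (cs : CoxeterSystem M W) {I J : Set B} {w x : W}
    (hx : x ∈ cs.doubleCoset I w J) : x⁻¹ ∈ cs.doubleCoset J w⁻¹ I := by
  obtain ⟨u, hu, v, hv, rfl⟩ := hx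
  exact ⟨v⁻¹, inv_mem hv, u⁻¹, inv_mem hu, by simp [mul_assoc]⟩

theorem getLast_mem_or_of_mul_wordProd_mem_doubleCoset (cs : CoxeterSystem M W) {I J : Set B}
    {w : W} (hI : ∀ s ∈ I, cs.length w < cs.length (cs.simple s * w))
    (hJ : ∀ s ∈ J, cs.length w < cs.length (w * cs.simple s)) {p : List B}
    (hc : p.IsChain cs.adjacent) (hn : p.Nodup)
    (hp : ∀ s ∈ p, cs.length w < cs.length (w * cs.simple s))
    (hmem : w * cs.wordProd p ∈ cs.doubleCoset I w J) {a b : B} (ha : p.head? = some a)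
    (hb : p.getLast? = some b) :
    b ∈ J ∨ ∃ t ∈ I, cs.simple t * w = w * cs.simple a := by
  have hinv : ∀ s, cs.length (cs.simple s * w⁻¹) = cs.length (w * cs.simple s) := fun s => by
    rw [← inv_simple, length_inv_mul_inv, inv_simple]
  have hinv' : ∀ s, cs.length (w⁻¹ * cs.simple s) = cs.length (cs.simple s * w) := fun s => by
    rw [← inv_simple, length_inv_mul_inv, inv_simple]
  rcases cs.head_mem_or_of_wordProd_mul_mem_doubleCoset (I := J) (J := I) (w := w⁻¹)
    (p := p.reverse) (fun s hs => by rw [hinv, length_inv]; exact hJ s hs)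
    (fun s hs => by rw [hinv', length_inv]; exact hI s hs)
    (by rw [List.isChain_reverse]; exact hc.imp fun _ _ => cs.adjacent_symm)
    (List.nodup_reverse.mpr hn)
    (fun s hs => by rw [hinv, length_inv]; exact hp s (List.mem_reverse.mp hs))
    (by simpa using cs.inv_mem_doubleCoset hmem)
    (by rw [List.head?_reverse]; exact hb) (by rw [List.getLast?_reverse]; exact ha)
    with h | ⟨t, ht, h⟩
  · exact Or.inl h
  · refine Or.inr ⟨t, ht, ?_⟩
    simpa using (congrArg (·⁻¹) h).symm

theorem adjacent_iff_not_commute (cs : CoxeterSystem M W) {s t : B} :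
    cs.adjacent s t ↔ ¬ Commute (cs.simple s) (cs.simple t) :=
  ⟨fun h => h.2, fun h => not_not.mp fun hc => h (cs.commute_of_not_adjacent hc)⟩

theorem simple_eq_inv_mul_mul_iff (cs : CoxeterSystem M W) {w : W} {a b : B} :
    cs.simple b = w⁻¹ * cs.simple a * w ↔ cs.simple a * w = w * cs.simple b := by
  rw [mul_assoc, eq_inv_mul_iff_mul_eq, eq_comm]

theorem adjacent_iff_of_simple_mul_eq (cs : CoxeterSystem M W) {w : W} {a a' b b' : B}
    (h : cs.simple a * w = w * cs.simple b) (h' : cs.simple a' * w = w * cs.simple b') :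
    cs.adjacent a a' ↔ cs.adjacent b b' := by
  rw [adjacent_iff_not_commute, adjacent_iff_not_commute, eq_mul_inv_of_mul_eq h,
    eq_mul_inv_of_mul_eq h', ← MulAut.conj_apply, ← MulAut.conj_apply, commute_iff_eq,
    commute_iff_eq, ← map_mul, ← map_mul, EmbeddingLike.apply_eq_iff_eq]

theorem eq_of_simple_mul_eq_mul_simple (cs : CoxeterSystem M W) {w : W} {a b b' : B}
    (h : cs.simple a * w = w * cs.simple b) (h' : cs.simple a * w = w * cs.simple b') : b = b' :=
  cs.simple_injective (mul_left_cancel (h.symm.trans h'))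

theorem self_mem_component (cs : CoxeterSystem M W) (X : Set B) (i : B) : i ∈ cs.component X i :=
  Relation.ReflTransGen.refl

theorem component_subset (cs : CoxeterSystem M W) {X : Set B} {i : B} (hi : i ∈ X) :
    cs.component X i ⊆ X := by
  intro j hj
  cases hj with
  | refl => exact hi
  | tail _ h => exact h.2.1

theorem mem_component_of_adjacent (cs : CoxeterSystem M W) {X : Set B} {i a b : B} (hi : i ∈ X)
    (ha : a ∈ cs.component X i) (hb : b ∈ X) (h : cs.adjacent a b) : b ∈ cs.component X i :=
  Relation.ReflTransGen.tail ha ⟨cs.component_subset hi ha, hb, h⟩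

theorem mem_component_symm (cs : CoxeterSystem M W) {X : Set B} {i j : B}
    (h : j ∈ cs.component X i) : i ∈ cs.component X j := by
  have : Std.Symm fun a b => a ∈ X ∧ b ∈ X ∧ cs.adjacent a b :=
    ⟨fun _ _ h => ⟨h.2.1, h.1, cs.adjacent_symm h.2.2⟩⟩
  exact Relation.ReflTransGen.stdSymm.symm _ _ h

theorem mem_component_trans (cs : CoxeterSystem M W) {X : Set B} {i j k : B}
    (h : j ∈ cs.component X i) (h' : k ∈ cs.component X j) : k ∈ cs.component X i :=
  Relation.ReflTransGen.trans h h'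

theorem commute_of_mem_component (cs : CoxeterSystem M W) {X : Set B} {i a b : B} (hi : i ∈ X)
    (ha : a ∈ cs.component X i) (hb : b ∈ X \ cs.component X i) :
    Commute (cs.simple a) (cs.simple b) :=
  cs.commute_of_not_adjacent fun h => hb.2 (cs.mem_component_of_adjacent hi ha hb.1 h)

theorem exists_path_of_mem_component (cs : CoxeterSystem M W) {X : Set B} {i j : B} (hi : i ∈ X)
    (hj : j ∈ cs.component X i) :
    ∃ p : List B, p.IsChain cs.adjacent ∧ p.Nodup ∧ (∀ s ∈ p, s ∈ X) ∧ p.head? = some i ∧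
      p.getLast? = some j := by
  have hjX := cs.component_subset hi hj
  clear hi
  induction hj using Relation.ReflTransGen.head_induction_on with
  | refl => exact ⟨[j], by simp, by simp, by simpa using hjX, rfl, rfl⟩
  | @head a c h _ ih =>
    obtain ⟨p, hc, hn, hX, hh, hl⟩ := ih
    by_cases ha : a ∈ p
    · obtain ⟨l, l', rfl⟩ := List.append_of_mem ha
      refine ⟨a :: l', (List.isChain_append.mp hc).2.1, (List.nodup_append.mp hn).2.1,
        fun s hs => hX s (List.mem_append_right _ hs), rfl, ?_⟩
      simpa using hl
    · cases p with
      | nil => simp at hh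
      | cons d p =>
        rw [List.head?_cons, Option.some_inj] at hh
        subst hh
        refine ⟨a :: d :: p, List.isChain_cons_cons.mpr ⟨h.2.2, hc⟩, List.nodup_cons.mpr ⟨ha, hn⟩,
          ?_, rfl, by simpa using hl⟩
        rw [List.forall_mem_cons]
        exact ⟨h.1, hX⟩

theorem exists_mul_of_mem_parabolic_union (cs : CoxeterSystem M W) {X Y : Set B}
    (h : ∀ a ∈ X, ∀ b ∈ Y, Commute (cs.simple a) (cs.simple b)) {u : W}
    (hu : u ∈ cs.parabolic (X ∪ Y)) :
    ∃ x ∈ cs.parabolic X, ∃ y ∈ cs.parabolic Y, u = x * y := by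
  obtain ⟨ω, hω, rfl⟩ := cs.mem_parabolic_iff.mp hu
  clear hu
  induction ω with
  | nil => exact ⟨1, one_mem _, 1, one_mem _, by simp⟩
  | cons i ω ih =>
    rw [List.forall_mem_cons] at hω
    obtain ⟨x, hx, y, hy, he⟩ := ih hω.2
    rw [wordProd_cons, he]
    rcases hω.1 with hi | hi
    · exact ⟨cs.simple i * x, mul_mem (cs.simple_mem_parabolic hi) hx, y, hy, (mul_assoc ..).symm⟩
    · refine ⟨x, hx, cs.simple i * y, mul_mem (cs.simple_mem_parabolic hi) hy, ?_⟩
      have hle : cs.parabolic X ≤ Subgroup.centralizer {cs.simple i} := by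
        refine (Subgroup.closure_le _).mpr ?_
        rintro _ ⟨a, ha, rfl⟩
        exact Subgroup.mem_centralizer_singleton_iff.mpr (h a ha i hi).eq
      rw [← mul_assoc, ← mul_assoc, Subgroup.mem_centralizer_singleton_iff.mp (hle hx)]

theorem exists_mul_eq_mul_of_mem_parabolic (cs : CoxeterSystem M W) {X Y : Set B} {w : W}
    (h : ∀ b ∈ Y, ∃ a ∈ X, cs.simple a * w = w * cs.simple b) {v : W}
    (hv : v ∈ cs.parabolic Y) : ∃ u ∈ cs.parabolic X, u * w = w * v := by
  obtain ⟨ω, hω, rfl⟩ := cs.mem_parabolic_iff.mp hv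
  clear hv
  induction ω with
  | nil => exact ⟨1, one_mem _, by simp⟩
  | cons i ω ih =>
    rw [List.forall_mem_cons] at hω
    obtain ⟨u, hu, he⟩ := ih hω.2
    obtain ⟨a, ha, hai⟩ := h i hω.1
    refine ⟨cs.simple a * u, mul_mem (cs.simple_mem_parabolic ha) hu, ?_⟩
    rw [wordProd_cons, mul_assoc, he, ← mul_assoc, hai, mul_assoc]

theorem doubleCoset_mono (cs : CoxeterSystem M W) {I I' J J' : Set B} (w : W) (hI : I ⊆ I')
    (hJ : J ⊆ J') : cs.doubleCoset I w J ⊆ cs.doubleCoset I' w J' := by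
  rintro _ ⟨u, hu, v, hv, rfl⟩
  exact ⟨u, cs.parabolic_mono hI hu, v, cs.parabolic_mono hJ hv, rfl⟩

theorem doubleCoset_union_right_subset (cs : CoxeterSystem M W) {I X Y : Set B} {w : W}
    (hcomm : ∀ a ∈ X, ∀ b ∈ Y, Commute (cs.simple a) (cs.simple b))
    (h : ∀ b ∈ X, ∃ a ∈ I, cs.simple a * w = w * cs.simple b) :
    cs.doubleCoset I w (X ∪ Y) ⊆ cs.doubleCoset I w Y := by
  rintro _ ⟨u, hu, v, hv, rfl⟩
  obtain ⟨x, hx, y, hy, rfl⟩ := cs.exists_mul_of_mem_parabolic_union hcomm hv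
  obtain ⟨u', hu', he⟩ := cs.exists_mul_eq_mul_of_mem_parabolic h hx
  exact ⟨u * u', mul_mem hu hu', y, hy, by rw [mul_assoc u u', he]; simp only [mul_assoc]⟩

theorem doubleCoset_union_left_subset (cs : CoxeterSystem M W) {J X Y : Set B} {w : W}
    (hcomm : ∀ a ∈ X, ∀ b ∈ Y, Commute (cs.simple a) (cs.simple b))
    (h : ∀ a ∈ X, ∃ b ∈ J, cs.simple a * w = w * cs.simple b) :
    cs.doubleCoset (X ∪ Y) w J ⊆ cs.doubleCoset Y w J := by
  intro z hz
  rw [← inv_inv z, ← inv_inv w]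
  refine cs.inv_mem_doubleCoset (cs.doubleCoset_union_right_subset hcomm (fun a ha => ?_)
    (cs.inv_mem_doubleCoset hz))
  obtain ⟨b, hb, he⟩ := h a ha
  exact ⟨b, hb, by simpa using (congrArg (·⁻¹) he).symm⟩

theorem wordProd_mul_mem_doubleCoset (cs : CoxeterSystem M W) {I J : Set B} {w : W} {p : List B}
    (hp : ∀ s ∈ p, s ∈ I) : cs.wordProd p * w ∈ cs.doubleCoset I w J :=
  ⟨_, cs.wordProd_mem_parabolic hp, 1, one_mem _, (mul_one _).symm⟩

theorem mul_wordProd_mem_doubleCoset (cs : CoxeterSystem M W) {I J : Set B} {w : W} {p : List B}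
    (hp : ∀ s ∈ p, s ∈ J) : w * cs.wordProd p ∈ cs.doubleCoset I w J :=
  ⟨1, one_mem _, _, cs.wordProd_mem_parabolic hp, by rw [one_mul]⟩

theorem not_component_subset_of_isLexMinimalPresentation [Finite B] (cs : CoxeterSystem M W)
    {I J : Set B} {w : W} (h : cs.IsLexMinimalPresentation I w J) {j : B} (hj : j ∈ J) :
    ¬ cs.component J j ⊆ {s | ∃ t ∈ I, cs.simple t * w = w * cs.simple s} := by
  intro hsub
  have he : cs.doubleCoset I w (J \ cs.component J j) = cs.doubleCoset I w J := by
    refine (cs.doubleCoset_mono w subset_rfl Set.sdiff_subset).antisymm ?_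
    conv_lhs => rw [← Set.union_sdiff_cancel (cs.component_subset hj)]
    exact cs.doubleCoset_union_right_subset
      (fun a ha b hb => cs.commute_of_mem_component hj ha hb) hsub
  have hlt : (J \ cs.component J j).ncard < J.ncard :=
    Set.ncard_lt_ncard ⟨Set.sdiff_subset, fun hc => (hc hj).2 (cs.self_mem_component J j)⟩
  have := h.2 _ _ he
  omega

theorem not_doubleCoset_diff_component_eq [Finite B] (cs : CoxeterSystem M W)
    {I J J' : Set B} {w : W} (h : cs.IsLexMinimalPresentation I w J) {i : B} (hi : i ∈ I) :
    cs.doubleCoset (I \ cs.component I i) w J' ≠ cs.doubleCoset I w J := by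
  intro he
  have hlt : (I \ cs.component I i).ncard < I.ncard :=
    Set.ncard_lt_ncard ⟨Set.sdiff_subset, fun hc => (hc hi).2 (cs.self_mem_component I i)⟩
  have := h.2 _ _ he
  omega

theorem not_subset_and_exists_of_isLexMinimalPresentation [Finite B] (cs : CoxeterSystem M W)
    {I J : Set B} {w : W} (h : cs.IsLexMinimalPresentation I w J) {i : B} (hi : i ∈ I)
    (hσ : ∀ a ∈ cs.component I i, ∃ b, cs.simple a * w = w * cs.simple b) :
    ¬ {b | ∃ a ∈ cs.component I i, cs.simple a * w = w * cs.simple b} ⊆ J ∧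
      ∃ j ∈ J, j ∈ {b | ∃ a ∈ cs.component I i, cs.simple a * w = w * cs.simple b} ∨
        ∃ b ∈ {b | ∃ a ∈ cs.component I i, cs.simple a * w = w * cs.simple b},
          cs.adjacent j b := by
  have hle : ∀ J', J ⊆ J' →
      {b | ∃ a ∈ cs.component I i, cs.simple a * w = w * cs.simple b} ⊆ J' →
      cs.doubleCoset I w J ⊆ cs.doubleCoset (I \ cs.component I i) w J' := by
    intro J' hJ' hsub
    refine (cs.doubleCoset_mono w subset_rfl hJ').trans ?_
    conv_lhs => rw [← Set.union_sdiff_cancel (cs.component_subset hi)]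
    refine cs.doubleCoset_union_left_subset
      (fun a ha b hb => cs.commute_of_mem_component hi ha hb) fun a ha => ?_
    obtain ⟨b, hb⟩ := hσ a ha
    exact ⟨b, hsub ⟨a, ha, hb⟩, hb⟩
  constructor
  · intro hsub
    exact cs.not_doubleCoset_diff_component_eq h hi
      ((cs.doubleCoset_mono w Set.sdiff_subset subset_rfl).antisymm (hle J subset_rfl hsub))
  · by_contra! hcon
    refine cs.not_doubleCoset_diff_component_eq h hi (Set.Subset.antisymm ?_
      (hle _ Set.subset_union_right Set.subset_union_left))
    refine (cs.doubleCoset_mono w Set.sdiff_subset subset_rfl).trans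
      (cs.doubleCoset_union_right_subset (fun a ha b hb => ?_) ?_)
    · exact (cs.commute_of_not_adjacent ((hcon b hb).2 a ha)).symm
    · rintro b ⟨a, ha, hab⟩
      exact ⟨a, cs.component_subset hi ha, hab⟩

theorem mem_component_of_simple_mul_eq (cs : CoxeterSystem M W) {I J : Set B} {w : W}
    {i y t₀ t : B} (h : ∀ r ∈ cs.component I i, ∃ t ∈ J, cs.simple r * w = w * cs.simple t)
    (h₀ : cs.simple i * w = w * cs.simple t₀) (hy : y ∈ cs.component I i)
    (ht : cs.simple y * w = w * cs.simple t) : t ∈ cs.component J t₀ := by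
  induction hy generalizing t with
  | refl =>
    rw [cs.eq_of_simple_mul_eq_mul_simple ht h₀]
    exact cs.self_mem_component J t₀
  | @tail x y hx hxy ih =>
    obtain ⟨t', ht'J, ht'⟩ := h x hx
    obtain ⟨t'', ht''J, ht''⟩ := h y (hx.tail hxy)
    rw [cs.eq_of_simple_mul_eq_mul_simple ht'' ht] at ht''J
    exact Relation.ReflTransGen.tail (ih ht')
      ⟨ht'J, ht''J, (cs.adjacent_iff_of_simple_mul_eq ht' ht).mp hxy.2.2⟩

theorem left_ascent_of_forall_mem_doubleCoset (cs : CoxeterSystem M W) {I J : Set B} {w : W}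
    (h : ∀ x ∈ cs.doubleCoset I w J, x ≠ w → cs.length w < cs.length x) :
    ∀ s ∈ I, cs.length w < cs.length (cs.simple s * w) := by
  intro s hs
  refine h _ ⟨_, cs.simple_mem_parabolic hs, 1, one_mem _, (mul_one _).symm⟩ fun he => ?_
  have := cs.length_simple_mul w s
  rw [he] at this
  omega

theorem right_ascent_of_forall_mem_doubleCoset (cs : CoxeterSystem M W) {I J : Set B} {w : W}
    (h : ∀ x ∈ cs.doubleCoset I w J, x ≠ w → cs.length w < cs.length x) :
    ∀ s ∈ J, cs.length w < cs.length (w * cs.simple s) := by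
  intro s hs
  refine h _ ⟨1, one_mem _, _, cs.simple_mem_parabolic hs, by rw [one_mul]⟩ fun he => ?_
  have := cs.length_mul_simple w s
  rw [he] at this
  omega

/-- A component of `J` that is not contained in `w⁻¹ I w` but meets or is adjacent to
`w⁻¹ I₀ w`, where `I₀` is a component of `I`, contains a vertex outside `w⁻¹ I w` that is
adjacent to `w⁻¹ I₀ w`. -/
theorem exists_adjacent_not_mem (cs : CoxeterSystem M W) {I J : Set B} {w : W} {s j : B}
    (hs : s ∈ I) (hj : j ∈ J)
    (ha : ¬ cs.component J j ⊆ {s | ∃ t ∈ I, cs.simple t * w = w * cs.simple s})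
    (h : j ∈ {b | ∃ a ∈ cs.component I s, cs.simple a * w = w * cs.simple b} ∨
        ∃ b ∈ {b | ∃ a ∈ cs.component I s, cs.simple a * w = w * cs.simple b},
          cs.adjacent j b) :
    ∃ k ∈ J, (¬ ∃ q ∈ I, cs.simple q * w = w * cs.simple k) ∧ ∃ a ∈ cs.component I s,
      ∃ b, cs.simple a * w = w * cs.simple b ∧ cs.adjacent b k := by
  have key : ∀ k ∈ J, k ∉ {b | ∃ a ∈ cs.component I s, cs.simple a * w = w * cs.simple b} →
      ∀ b ∈ {b | ∃ a ∈ cs.component I s, cs.simple a * w = w * cs.simple b}, cs.adjacent b k →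
      ∃ k ∈ J, (¬ ∃ q ∈ I, cs.simple q * w = w * cs.simple k) ∧ ∃ a ∈ cs.component I s,
        ∃ b, cs.simple a * w = w * cs.simple b ∧ cs.adjacent b k := by
    rintro k hk hkn b ⟨a, haI, hab⟩ hbk
    refine ⟨k, hk, ?_, a, haI, b, hab, hbk⟩
    rintro ⟨q, hq, hqk⟩
    exact hkn ⟨q, cs.mem_component_of_adjacent hs haI hq
      ((cs.adjacent_iff_of_simple_mul_eq hab hqk).mpr hbk), hqk⟩
  by_cases hjσ : j ∈ {b | ∃ a ∈ cs.component I s, cs.simple a * w = w * cs.simple b}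
  · obtain ⟨e, he, hen⟩ := Set.not_subset.mp ha
    by_contra hcon
    suffices e ∈ {b | ∃ a ∈ cs.component I s, cs.simple a * w = w * cs.simple b} by
      obtain ⟨a, haI, hae⟩ := this
      exact hen ⟨a, cs.component_subset hs haI, hae⟩
    clear hen
    induction he with
    | refl => exact hjσ
    | tail _ hxy ih =>
      by_contra hy
      exact hcon (key _ hxy.2.1 hy _ ih hxy.2.2)
  · obtain ⟨b, hb, hjb⟩ := h.resolve_left hjσ
    exact key j hj hjσ b hb (cs.adjacent_symm hjb)

/-- If `W_I w W_J = W_{I'} w W_{J'}`, then each component of `I` not contained in `I'` is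
conjugated into `J'` by `w`. -/
theorem exists_mem_of_doubleCoset_eq (cs : CoxeterSystem M W) {I J I' J' : Set B} {w : W}
    (hI : ∀ s ∈ I, cs.length w < cs.length (cs.simple s * w))
    (hI' : ∀ s ∈ I', cs.length w < cs.length (cs.simple s * w))
    (hJ' : ∀ s ∈ J', cs.length w < cs.length (w * cs.simple s))
    (he : cs.doubleCoset I' w J' = cs.doubleCoset I w J) {s r : B} (hs : s ∈ I) (hsn : s ∉ I')
    (hr : r ∈ cs.component I s) : ∃ t ∈ J', cs.simple r * w = w * cs.simple t := by
  obtain ⟨p, hc, hn, hpI, hh, hl⟩ := cs.exists_path_of_mem_component hs hr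
  exact (cs.head_mem_or_of_wordProd_mul_mem_doubleCoset hI' hJ' hc hn
    (fun i hi => hI i (hpI i hi)) (he ▸ cs.wordProd_mul_mem_doubleCoset hpI) hh hl).resolve_left hsn

/-- If `W_I w W_J = W_{I'} w W_{J'}`, then each component of `J` not contained in `J'` is
conjugated into `I'` by `w⁻¹`. -/
theorem exists_mem_of_doubleCoset_eq' (cs : CoxeterSystem M W) {I J I' J' : Set B} {w : W}
    (hJ : ∀ s ∈ J, cs.length w < cs.length (w * cs.simple s))
    (hI' : ∀ s ∈ I', cs.length w < cs.length (cs.simple s * w))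
    (hJ' : ∀ s ∈ J', cs.length w < cs.length (w * cs.simple s))
    (he : cs.doubleCoset I' w J' = cs.doubleCoset I w J) {s r : B} (hs : s ∈ J) (hsn : s ∉ J')
    (hr : r ∈ cs.component J s) : ∃ t ∈ I', cs.simple t * w = w * cs.simple r := by
  obtain ⟨p, hc, hn, hpJ, hh, hl⟩ := cs.exists_path_of_mem_component
    (cs.component_subset hs hr) (cs.mem_component_symm hr)
  exact (cs.getLast_mem_or_of_mul_wordProd_mem_doubleCoset hI' hJ' hc hn
    (fun i hi => hJ i (hpJ i hi)) (he ▸ cs.mul_wordProd_mem_doubleCoset hpJ) hh hl).resolve_left hsn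

theorem subset_of_doubleCoset_eq (cs : CoxeterSystem M W) {I J I' J' : Set B} {w : W}
    (hI : ∀ s ∈ I, cs.length w < cs.length (cs.simple s * w))
    (hJ : ∀ s ∈ J, cs.length w < cs.length (w * cs.simple s))
    (hI' : ∀ s ∈ I', cs.length w < cs.length (cs.simple s * w))
    (hJ' : ∀ s ∈ J', cs.length w < cs.length (w * cs.simple s))
    (he : cs.doubleCoset I' w J' = cs.doubleCoset I w J)
    (ha : ∀ j ∈ J, ¬ cs.component J j ⊆ {s | ∃ t ∈ I, cs.simple t * w = w * cs.simple s})
    (hb : ∀ i ∈ I, (∀ a ∈ cs.component I i, ∃ b, cs.simple a * w = w * cs.simple b) →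
      ¬ {b | ∃ a ∈ cs.component I i, cs.simple a * w = w * cs.simple b} ⊆ J ∧
      ∃ j ∈ J, j ∈ {b | ∃ a ∈ cs.component I i, cs.simple a * w = w * cs.simple b} ∨
        ∃ b ∈ {b | ∃ a ∈ cs.component I i, cs.simple a * w = w * cs.simple b},
          cs.adjacent j b) : I ⊆ I' := by
  intro s hs
  by_contra hsn
  have hσ : ∀ r ∈ cs.component I s, ∃ t ∈ J', cs.simple r * w = w * cs.simple t := fun r hr =>
    cs.exists_mem_of_doubleCoset_eq hI hI' hJ' he hs hsn hr
  obtain ⟨hnot, j, hj, hjor⟩ := hb s hs fun r hr => (hσ r hr).imp fun _ h => h.2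
  obtain ⟨b, ⟨a, haI, hab⟩, hbJ⟩ := Set.not_subset.mp hnot
  obtain ⟨k, hk, hkn, c, hcI, d, hcd, hdk⟩ := cs.exists_adjacent_not_mem hs hj (ha j hj) hjor
  have hkJ' : k ∈ J' := by
    by_contra hkJ'
    obtain ⟨q, hq, hqk⟩ := cs.exists_mem_of_doubleCoset_eq' hJ hI' hJ' he hk hkJ'
      (cs.self_mem_component J k)
    have hqI : q ∉ I := fun h => hkn ⟨q, h, hqk⟩
    obtain ⟨p, hc, hn, hpI, hh, hl⟩ := cs.exists_path_of_mem_component hs hcI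
    have hmem : cs.wordProd (p ++ [q]) * w ∈ cs.doubleCoset I' w J' := by
      rw [he, wordProd_append, wordProd_singleton, mul_assoc, hqk, ← mul_assoc]
      exact ⟨_, cs.wordProd_mem_parabolic hpI, _, cs.simple_mem_parabolic hk, rfl⟩
    have hchain : (p ++ [q]).IsChain cs.adjacent := by
      refine List.isChain_append.mpr ⟨hc, by simp, fun x hx y hy => ?_⟩
      rw [hl, Option.mem_some_iff] at hx
      rw [List.head?_cons, Option.mem_some_iff] at hy
      subst hx hy
      exact (cs.adjacent_iff_of_simple_mul_eq hcd hqk).mpr hdk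
    have hnodup : (p ++ [q]).Nodup :=
      List.nodup_append.mpr ⟨hn, by simp, fun x hx y hy hxy => hqI (by
        rw [List.mem_singleton] at hy
        exact hy ▸ hxy ▸ hpI x hx)⟩
    have hasc : ∀ i ∈ p ++ [q], cs.length w < cs.length (cs.simple i * w) := fun i hi => by
      rcases List.mem_append.mp hi with hi | hi
      · exact hI i (hpI i hi)
      · rw [List.mem_singleton.mp hi]
        exact hI' q hq
    rcases cs.head_mem_or_of_wordProd_mul_mem_doubleCoset hI' hJ' hchain hnodup hasc
      hmem (a := s) (b := q) (by rw [List.head?_append, hh]; rfl) (by simp) with h | ⟨t, ht, hqt⟩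
    · exact hsn h
    · exact hkJ' (cs.eq_of_simple_mul_eq_mul_simple hqt hqk ▸ ht)
  obtain ⟨t₀, -, ht₀⟩ := hσ s (cs.self_mem_component I s)
  obtain ⟨d', hd', hcd'⟩ := hσ c hcI
  rw [cs.eq_of_simple_mul_eq_mul_simple hcd' hcd] at hd'
  obtain ⟨b', hb', hab'⟩ := hσ a haI
  rw [cs.eq_of_simple_mul_eq_mul_simple hab' hab] at hb'
  have hbk : k ∈ cs.component J' b := by
    refine cs.mem_component_of_adjacent hb' ?_ hkJ' hdk
    exact cs.mem_component_trans
      (cs.mem_component_symm (cs.mem_component_of_simple_mul_eq hσ ht₀ haI hab))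
      (cs.mem_component_of_simple_mul_eq hσ ht₀ hcI hcd)
  exact hkn (cs.exists_mem_of_doubleCoset_eq' hJ' hI hJ he.symm hb' hbJ hbk)

end CoxeterSystem

/-- Characterization of lex-minimal presentations: if `I` consists of left ascents of `w`
and `J` of right ascents of `w`, then `W_I w W_J` is lex-minimal iff (a) no connected
component of `J` is contained in `(w⁻¹ I w) ∩ S` and (b) whenever a connected component
`I₀` of `I` satisfies `w⁻¹ I₀ w ⊆ S`, then `w⁻¹ I₀ w ⊄ J` and some element of `J` is
adjacent to or contained in `w⁻¹ I₀ w`. -/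
theorem lex_minimal_presentation_characterization
    [Fintype B] {M : CoxeterMatrix B} (cs : CoxeterSystem M W)
    (I J : Set B) (w : W)
    (hI : ∀ s ∈ I, cs.length w < cs.length (cs.simple s * w))
    (hJ : ∀ s ∈ J, cs.length w < cs.length (w * cs.simple s)) :
    cs.IsLexMinimalPresentation I w J ↔
      ((∀ j ∈ J, ¬ (cs.component J j ⊆
          {s : B | ∃ t ∈ I, cs.simple s = w⁻¹ * cs.simple t * w})) ∧
       (∀ i ∈ I, (∀ a ∈ cs.component I i, ∃ b : B, cs.simple b = w⁻¹ * cs.simple a * w) →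
          (¬ ({b : B | ∃ a ∈ cs.component I i, cs.simple b = w⁻¹ * cs.simple a * w} ⊆ J) ∧
            ∃ j ∈ J,
              j ∈ {b : B | ∃ a ∈ cs.component I i, cs.simple b = w⁻¹ * cs.simple a * w} ∨
              ∃ b ∈ {b : B | ∃ a ∈ cs.component I i,
                  cs.simple b = w⁻¹ * cs.simple a * w}, cs.adjacent j b))) := by
  simp only [cs.simple_eq_inv_mul_mul_iff]
  constructor
  · exact fun h => ⟨fun j hj => cs.not_component_subset_of_isLexMinimalPresentation h hj,
      fun i hi hσ => cs.not_subset_and_exists_of_isLexMinimalPresentation h hi hσ⟩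
  · rintro ⟨ha, hb⟩
    have hmin : ∀ x ∈ cs.doubleCoset I w J, x ≠ w → cs.length w < cs.length x :=
      fun x hx => cs.length_lt_of_mem_doubleCoset hI hJ hx
    refine ⟨hmin, fun I' J' he => ?_⟩
    have hI' := cs.left_ascent_of_forall_mem_doubleCoset (he.symm ▸ hmin)
    have hJ' := cs.right_ascent_of_forall_mem_doubleCoset (he.symm ▸ hmin)
    have hII' := cs.subset_of_doubleCoset_eq hI hJ hI' hJ' he ha hb
    rcases (Set.ncard_le_ncard hII').lt_or_eq with hlt | heq
    · exact Or.inl hlt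
    · refine Or.inr ⟨heq, Set.ncard_le_ncard fun j hj => ?_⟩
      by_contra hjn
      obtain rfl := Set.eq_of_subset_of_ncard_le hII' heq.ge
      exact ha j hj fun k hk => cs.exists_mem_of_doubleCoset_eq' hJ hI' hJ' he hj hjn hk
end

section
/- For all n ≥ 4, the total number of tethers over the symmetric group satisfies ∑_{w ∈ S_n} |tethers(w)| = (n−3)·(n−4)·(n−3)!; equivalently, the expected value of |tethers(w)| over w ∈ S_n chosen uniformly is (n−3)(n−4)/(n(n−1)(n−2)). -/
/-- The value of `w ∈ S_n` at the 1-indexed position `k` (so `permVal w k = w(k)` for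
`1 ≤ k ≤ n`, and `permVal w k = k` otherwise). -/
def permVal {n : ℕ} (w : Equiv.Perm (Fin n)) (k : ℕ) : ℕ :=
  if h : 1 ≤ k ∧ k ≤ n then (w ⟨k - 1, by omega⟩ : ℕ) + 1 else k

/-- `k` is a right tether of `w ∈ S_n`: `2 ≤ k ≤ n - 2`, the values at positions
`k - 1, k` and at `k + 1, k + 2` are consecutive, and the jump between positions
`k` and `k + 1` is more than one. -/
def IsRightTether {n : ℕ} (w : Equiv.Perm (Fin n)) (k : ℕ) : Prop :=
  2 ≤ k ∧ k + 2 ≤ n ∧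
    permVal w k = permVal w (k - 1) + 1 ∧
    permVal w (k + 2) = permVal w (k + 1) + 1 ∧
    permVal w k + 1 < permVal w (k + 1)

/-- The total number of tethers of `w`: the number of right tethers of `w` plus the
number of right tethers of `w⁻¹` (i.e. the left tethers of `w`). -/
noncomputable def tethersCount {n : ℕ} (w : Equiv.Perm (Fin n)) : ℕ :=
  {k : ℕ | IsRightTether w k}.ncard + {k : ℕ | IsRightTether w⁻¹ k}.ncard

/-- The number of permutations of `α` extending a given partial injection. -/
theorem card_perm_extending {α ι : Type*} [Fintype α] [DecidableEq α] [Fintype ι]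
    (f g : ι ↪ α) :
    Fintype.card {w : Equiv.Perm α // ∀ x, w (f x) = g x} =
      (Fintype.card α - Fintype.card ι).factorial := by
  classical
  let e : {x // x ∈ Set.range f} ≃ {x // x ∈ Set.range g} :=
    (Equiv.ofInjective f f.injective).symm.trans (Equiv.ofInjective g g.injective)
  let σ : Equiv.Perm α := e.extendSubtype
  have hσ : ∀ x, σ (f x) = g x := fun x => by
    have h := e.extendSubtype_apply_of_mem (f x) (Set.mem_range_self x)
    have h' : (⟨f x, Set.mem_range_self x⟩ : {y // y ∈ Set.range f}) =
        Equiv.ofInjective f f.injective x := rfl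
    rw [h, h']
    change (Equiv.ofInjective g g.injective ((Equiv.ofInjective f f.injective).symm _) : α) = g x
    rw [Equiv.symm_apply_apply, Equiv.ofInjective_apply]
  have e1 : {w : Equiv.Perm α // ∀ x, w (f x) = g x} ≃
      {w : Equiv.Perm α // ∀ a, ¬ (a ∉ Set.range f) → w a = a} :=
    (Equiv.mulLeft σ⁻¹).subtypeEquiv fun w => by
      simp only [not_not, Set.mem_range, forall_exists_index, forall_apply_eq_imp_iff,
        Equiv.coe_mulLeft, Equiv.Perm.mul_apply, Equiv.Perm.inv_eq_iff_eq, hσ]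
  rw [Fintype.card_congr (e1.trans (Equiv.Perm.subtypeEquivSubtypePerm _).symm),
    Fintype.card_perm, Fintype.card_subtype_compl]
  congr 2
  exact Set.card_range_of_injective f.injective

/-- The number of pairs `(i, j)` with `i + 3 ≤ j` and `j + 1 < m + 4`, doubled. -/
theorem card_separated_pairs (m : ℕ) :
    ((Finset.range (m + 3)).sigma fun j => Finset.range (j - 2)).card * 2 = (m + 1) * m := by
  rw [Finset.card_sigma, Finset.sum_range_succ', Finset.sum_range_succ']
  simpa using Finset.sum_range_id_mul_two (m + 1)

theorem permVal_succ {n : ℕ} (w : Equiv.Perm (Fin n)) (a : ℕ) (ha : a < n) :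
    permVal w (a + 1) = (w ⟨a, ha⟩ : ℕ) + 1 := by
  simp [permVal, Nat.succ_le_of_lt ha]

theorem isRightTether_iff {m : ℕ} (w : Equiv.Perm (Fin (m + 4))) (a : ℕ) (ha : a < m + 1) :
    IsRightTether w (a + 2) ↔
      (w ⟨a + 1, by omega⟩ : ℕ) = w ⟨a, by omega⟩ + 1 ∧
      (w ⟨a + 3, by omega⟩ : ℕ) = w ⟨a + 2, by omega⟩ + 1 ∧
      (w ⟨a + 1, by omega⟩ : ℕ) + 1 < w ⟨a + 2, by omega⟩ := by
  have h0 := permVal_succ w a (by omega)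
  have h1 := permVal_succ w (a + 1) (by omega)
  have h2 := permVal_succ w (a + 2) (by omega)
  have h3 := permVal_succ w (a + 3) (by omega)
  simp only [IsRightTether, show a + 2 - 1 = a + 1 by omega, show a + 2 + 2 = a + 3 + 1 by omega,
    h0, h2, h3, show a + 2 = a + 1 + 1 by omega, h1]
  omega

open Classical in
/-- The number of permutations with a right tether at a given admissible position. -/
theorem card_isRightTether (m a : ℕ) (ha : a < m + 1) :
    (Finset.univ.filter fun w : Equiv.Perm (Fin (m + 4)) => IsRightTether w (a + 2)).card =
      ((Finset.range (m + 3)).sigma fun j => Finset.range (j - 2)).card * m.factorial := by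
  rw [Finset.card_eq_sum_card_fiberwise
    (f := fun w : Equiv.Perm (Fin (m + 4)) =>
      (⟨(w ⟨a + 2, by omega⟩ : ℕ), (w ⟨a, by omega⟩ : ℕ)⟩ : Σ _ : ℕ, ℕ))
    (t := (Finset.range (m + 3)).sigma fun j => Finset.range (j - 2)),
    Finset.sum_const_nat]
  · rintro ⟨j, i⟩ hij
    simp only [Finset.mem_sigma, Finset.mem_range] at hij
    obtain ⟨hj, hi⟩ := hij
    let f : Fin 4 ↪ Fin (m + 4) :=
      ⟨fun x => ⟨a + x, by omega⟩, fun x y h => by simp at h; omega⟩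
    let g : Fin 4 ↪ Fin (m + 4) :=
      ⟨![⟨i, by omega⟩, ⟨i + 1, by omega⟩, ⟨j, by omega⟩, ⟨j + 1, by omega⟩], fun x y h => by
        fin_cases x <;> fin_cases y <;> simp at h ⊢ <;> omega⟩
    have hcard := card_perm_extending f g
    rw [Fintype.card_fin, Fintype.card_fin, Nat.add_sub_cancel, Fintype.card_subtype] at hcard
    rw [← hcard, Finset.filter_filter]
    congr 1
    ext w
    have hfg : (∀ x, w (f x) = g x) ↔ (w ⟨a, by omega⟩ : ℕ) = i ∧
        (w ⟨a + 1, by omega⟩ : ℕ) = i + 1 ∧ (w ⟨a + 2, by omega⟩ : ℕ) = j ∧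
        (w ⟨a + 3, by omega⟩ : ℕ) = j + 1 := by
      simp only [Fin.forall_fin_succ, IsEmpty.forall_iff, and_true, Fin.ext_iff]
      rfl
    simp only [Finset.mem_filter, Finset.mem_univ, true_and, isRightTether_iff w a ha,
      Sigma.mk.injEq, heq_eq_eq, hfg]
    omega
  · intro w hw
    have hw' := (isRightTether_iff w a ha).1 (by simpa using hw)
    have := (w ⟨a + 3, by omega⟩).isLt
    simp only [Finset.coe_sigma, Set.mem_sigma_iff, Finset.mem_coe, Finset.mem_range]
    omega

open Classical in
theorem ncard_isRightTether {m : ℕ} (w : Equiv.Perm (Fin (m + 4))) :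
    {k : ℕ | IsRightTether w k}.ncard =
      ((Finset.range (m + 1)).filter fun a => IsRightTether w (a + 2)).card := by
  rw [← Finset.card_map (addRightEmbedding 2), ← Set.ncard_coe_finset]
  congr 1
  ext k
  simp only [Set.mem_ofPred_eq, Finset.coe_map, Set.mem_image, Finset.mem_coe, Finset.mem_filter,
    Finset.mem_range, addRightEmbedding_apply]
  constructor
  · intro h
    have h1 := h.1
    have h2 := h.2.1
    refine ⟨k - 2, ⟨by omega, ?_⟩, by omega⟩
    rwa [Nat.sub_add_cancel h1]
  · rintro ⟨a, ⟨-, h⟩, rfl⟩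
    exact h

/-- The total number of right tethers over the symmetric group. -/
theorem sum_ncard_isRightTether (m : ℕ) :
    ∑ w : Equiv.Perm (Fin (m + 4)), {k : ℕ | IsRightTether w k}.ncard =
      (m + 1) * (((Finset.range (m + 3)).sigma fun j => Finset.range (j - 2)).card *
        m.factorial) := by
  classical
  simp only [ncard_isRightTether]
  have h := Finset.sum_card_bipartiteAbove_eq_sum_card_bipartiteBelow
    (s := (Finset.univ : Finset (Equiv.Perm (Fin (m + 4))))) (t := Finset.range (m + 1))
    (fun w a => IsRightTether w (a + 2))
  simp only [Finset.bipartiteAbove, Finset.bipartiteBelow] at h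
  rw [h, Finset.sum_const_nat fun a ha => card_isRightTether m a (Finset.mem_range.1 ha),
    Finset.card_range]

theorem sum_tethersCount (m : ℕ) :
    ∑ w : Equiv.Perm (Fin (m + 4)), tethersCount w = (m + 1) * m * (m + 1).factorial := by
  have hinv : ∑ w : Equiv.Perm (Fin (m + 4)), {k : ℕ | IsRightTether w⁻¹ k}.ncard =
      ∑ w : Equiv.Perm (Fin (m + 4)), {k : ℕ | IsRightTether w k}.ncard :=
    Equiv.sum_comp (Equiv.inv (Equiv.Perm (Fin (m + 4)))) fun w => {k : ℕ | IsRightTether w k}.ncard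
  simp only [tethersCount, Finset.sum_add_distrib]
  rw [hinv, sum_ncard_isRightTether, Nat.factorial_succ, ← card_separated_pairs m]
  ring

/-- The total number of tethers over `S_n` is `(n-3)(n-4)(n-3)!`; equivalently the
expected number of tethers of a uniformly random permutation of `S_n` is
`(n-3)(n-4)/(n(n-1)(n-2))`. -/
theorem expected_number_of_tethers (n : ℕ) (hn : 4 ≤ n) :
    (∑ w : Equiv.Perm (Fin n), tethersCount w) =
      (n - 3) * (n - 4) * Nat.factorial (n - 3) ∧
    ((∑ w : Equiv.Perm (Fin n), (tethersCount w : ℚ)) / (Nat.factorial n : ℚ) =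
      ((n : ℚ) - 3) * ((n : ℚ) - 4) / ((n : ℚ) * ((n : ℚ) - 1) * ((n : ℚ) - 2))) := by
  obtain ⟨m, rfl⟩ := Nat.exists_eq_add_of_le' hn
  have hsum := sum_tethersCount m
  refine ⟨by simpa using hsum, ?_⟩
  rw [← Nat.cast_sum, hsum]
  have hm : (m.factorial : ℚ) ≠ 0 := by exact_mod_cast m.factorial_ne_zero
  have h1 : (m : ℚ) + 4 - 1 = m + 3 := by ring
  have h2 : (m : ℚ) + 4 - 2 = m + 2 := by ring
  have h3 : (m : ℚ) + 4 - 3 = m + 1 := by ring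
  simp only [Nat.factorial_succ]
  push_cast
  rw [h1, h2, h3, div_eq_div_iff (by positivity) (by positivity)]
  ring
end

section
/- For n ≥ 1 let d_n denote the number of distinct subsets of the symmetric group S_n of the form W_I · W_J = { u v : u ∈ W_I, v ∈ W_J } as I and J range over all subsets of {1, …, n−1} (equivalently, the number of parabolic double cosets of S_n whose minimal-length element is the identity). Then d_1 = 1, d_2 = 2, d_3 = 6, and d_n = 5 d_{n−1} − 7 d_{n−2} + 4 d_{n−3} for all n ≥ 4 (so d_4 = 20, d_5 = 66). -/
/-- The adjacent transposition `s_i ∈ S_n`, swapping the 1-indexed positions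
`i` and `i + 1`. -/
def adjT (n : ℕ) (i : ℕ) : Equiv.Perm (Fin n) :=
  if h : 1 ≤ i ∧ i + 1 ≤ n then Equiv.swap ⟨i - 1, by omega⟩ ⟨i, by omega⟩ else 1

/-- The Young subgroup `W_I` of `S_n` generated by the adjacent transpositions `s_i`,
`i ∈ I`. -/
def youngSubgroup (n : ℕ) (I : Set ℕ) : Subgroup (Equiv.Perm (Fin n)) :=
  Subgroup.closure {x | ∃ i ∈ I, x = adjT n i}

/-- The collection of all subsets of `S_n` of the form
`W_I ⬝ W_J = { u * v : u ∈ W_I, v ∈ W_J }`, i.e. the parabolic double cosets of `S_n`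
whose minimal-length element is the identity. -/
def identityDoubleCosets (n : ℕ) : Set (Set (Equiv.Perm (Fin n))) :=
  {C | ∃ I J : Set ℕ,
    C = {x | ∃ u ∈ youngSubgroup n I, ∃ v ∈ youngSubgroup n J, x = u * v}}

/-- `dSeq n` is the number of distinct sets `W_I ⬝ W_J` in `S_n`. -/
noncomputable def dSeq (n : ℕ) : ℕ := (identityDoubleCosets n).ncard

open scoped Pointwise

/-- The set `W_I ⬝ W_J`. -/
def youngProduct (n : ℕ) (I J : Set ℕ) : Set (Equiv.Perm (Fin n)) :=
  {x | ∃ u ∈ youngSubgroup n I, ∃ v ∈ youngSubgroup n J, x = u * v}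

/-- The indices `i` of the simple reflections whose left multiplication preserves `C`. -/
def leftStabilizerIndices (n : ℕ) (C : Set (Equiv.Perm (Fin n))) : Set ℕ :=
  {i | i ∈ Set.Ico 1 n ∧ ∀ x ∈ C, adjT n i * x ∈ C}

/-- Every index in `N \ M` can reach an index of `M \ N` by moving only through indices of
`M ∩ N`. -/
def Linked (M N : Set ℕ) : Prop :=
  ∀ i ∈ N \ M, ∃ j ∈ M \ N, ∀ k, (i < k ∧ k < j) ∨ (j < k ∧ k < i) → k ∈ M ∩ N

theorem adjT_of_mem {n i : ℕ} (h1 : 1 ≤ i) (h2 : i < n) :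
    adjT n i = Equiv.swap ⟨i - 1, by omega⟩ ⟨i, h2⟩ := by
  simp [adjT, h1, Nat.succ_le_of_lt h2]

theorem adjT_of_notMem {n i : ℕ} (h : i ∉ Set.Ico 1 n) : adjT n i = 1 := by
  exact dif_neg fun h' => h ⟨h'.1, h'.2⟩

theorem adjT_mul_self (n i : ℕ) : adjT n i * adjT n i = 1 := by
  unfold adjT; split_ifs <;> simp

theorem adjT_inv (n i : ℕ) : (adjT n i)⁻¹ = adjT n i :=
  inv_eq_of_mul_eq_one_left (adjT_mul_self n i)

theorem adjT_val_lt_iff {n i j : ℕ} (h : j ≠ i) (a : Fin n) :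
    (adjT n j a : ℕ) < i ↔ (a : ℕ) < i := by
  by_cases hj : j ∈ Set.Ico 1 n
  · rw [adjT_of_mem hj.1 hj.2, Equiv.swap_apply_def]
    have := hj.1
    split_ifs with h1 h2
    · subst h1; simp; omega
    · subst h2; simp; omega
    · rfl
  · simp [adjT_of_notMem hj]

theorem adjT_commute {n i j : ℕ} (h : i + 2 ≤ j ∨ j + 2 ≤ i) :
    Commute (adjT n i) (adjT n j) := by
  by_cases hi : i ∈ Set.Ico 1 n
  · by_cases hj : j ∈ Set.Ico 1 n
    · rw [adjT_of_mem hi.1 hi.2, adjT_of_mem hj.1 hj.2]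
      have := hi.1
      have := hj.1
      apply Equiv.Perm.Disjoint.commute
      intro a
      by_cases ha : (a : ℕ) = i - 1 ∨ (a : ℕ) = i
      · right
        apply Equiv.swap_apply_of_ne_of_ne <;> simp only [ne_eq, Fin.ext_iff] <;> omega
      · left
        apply Equiv.swap_apply_of_ne_of_ne <;> simp only [ne_eq, Fin.ext_iff] <;> omega
    · simp [adjT_of_notMem hj]
  · simp [adjT_of_notMem hi]

theorem adjT_mem_youngSubgroup {n i : ℕ} {I : Set ℕ} (h : i ∈ I) :
    adjT n i ∈ youngSubgroup n I :=
  Subgroup.subset_closure ⟨i, h, rfl⟩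

theorem youngSubgroup_mono {n : ℕ} {I J : Set ℕ} (h : I ⊆ J) :
    youngSubgroup n I ≤ youngSubgroup n J :=
  Subgroup.closure_mono fun _ ⟨i, hi, hx⟩ => ⟨i, h hi, hx⟩

theorem youngSubgroup_le_of_inter {n : ℕ} {I J : Set ℕ} (h : I ∩ Set.Ico 1 n ⊆ J) :
    youngSubgroup n I ≤ youngSubgroup n J := by
  refine (Subgroup.closure_le _).2 ?_
  rintro x ⟨i, hi, rfl⟩
  by_cases hn : i ∈ Set.Ico 1 n
  · exact adjT_mem_youngSubgroup (h ⟨hi, hn⟩)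
  · rw [adjT_of_notMem hn]; exact one_mem _

theorem youngSubgroup_induction {n : ℕ} {I : Set ℕ} {p : Equiv.Perm (Fin n) → Prop}
    (one : p 1) (mul : ∀ u i, i ∈ I → p u → p (u * adjT n i))
    {u : Equiv.Perm (Fin n)} (hu : u ∈ youngSubgroup n I) : p u := by
  induction hu using Subgroup.closure_induction_right with
  | one => exact one
  | mul_right x _ y hy hx =>
    obtain ⟨i, hi, rfl⟩ := hy
    exact mul _ _ hi hx
  | mul_inv_cancel x _ y hy hx =>
    obtain ⟨i, hi, rfl⟩ := hy
    rw [adjT_inv]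
    exact mul _ _ hi hx

theorem youngSubgroup_val_lt_iff {n i : ℕ} {I : Set ℕ} (hi : i ∉ I)
    {u : Equiv.Perm (Fin n)} (hu : u ∈ youngSubgroup n I) (a : Fin n) :
    (u a : ℕ) < i ↔ (a : ℕ) < i := by
  revert a
  refine youngSubgroup_induction (p := fun u => ∀ a, (u a : ℕ) < i ↔ (a : ℕ) < i)
    (by simp) ?_ hu
  intro u j hj hu a
  rw [Equiv.Perm.mul_apply, hu, adjT_val_lt_iff]
  rintro rfl
  exact hi hj

theorem swap_mem_youngSubgroup {n : ℕ} {I : Set ℕ} (a b : ℕ) (hab : a ≤ b) (hb : b < n)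
    (h : ∀ k, a < k → k ≤ b → k ∈ I) :
    Equiv.swap (⟨a, hab.trans_lt hb⟩ : Fin n) ⟨b, hb⟩ ∈ youngSubgroup n I := by
  induction b, hab using Nat.le_induction with
  | base => simp [Equiv.swap_self, ← Equiv.Perm.one_def, one_mem]
  | succ b hab ih =>
    have ih' := ih (by omega) fun k h1 h2 => h k h1 (by omega)
    have hs : Equiv.swap (⟨b, by omega⟩ : Fin n) ⟨b + 1, hb⟩ ∈ youngSubgroup n I := by
      have := adjT_mem_youngSubgroup (n := n) (h (b + 1) (by omega) le_rfl)
      rwa [adjT_of_mem (by omega) hb] at this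
    exact SubmonoidClass.swap_mem_trans _ ih' hs

theorem inv_youngProduct (n : ℕ) (I J : Set ℕ) :
    (youngProduct n I J)⁻¹ = youngProduct n J I := by
  ext x
  constructor
  · rintro ⟨u, hu, v, hv, h⟩
    exact ⟨v⁻¹, inv_mem hv, u⁻¹, inv_mem hu, by rw [← mul_inv_rev, ← h, inv_inv]⟩
  · rintro ⟨u, hu, v, hv, rfl⟩
    exact ⟨v⁻¹, inv_mem hv, u⁻¹, inv_mem hu, by rw [mul_inv_rev]⟩

theorem inter_Ico_subset_leftStabilizerIndices (n : ℕ) (I J : Set ℕ) :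
    I ∩ Set.Ico 1 n ⊆ leftStabilizerIndices n (youngProduct n I J) := by
  rintro i ⟨hi, hn⟩
  refine ⟨hn, ?_⟩
  rintro _ ⟨u, hu, v, hv, rfl⟩
  exact ⟨adjT n i * u, mul_mem (adjT_mem_youngSubgroup hi) hu, v, hv, (mul_assoc _ _ _).symm⟩

theorem adjT_apply_self {n i : ℕ} (h1 : 1 ≤ i) (h2 : i < n) :
    adjT n i ⟨i, h2⟩ = ⟨i - 1, by omega⟩ := by
  rw [adjT_of_mem h1 h2, Equiv.swap_apply_right]

theorem adjT_apply_pred {n i : ℕ} (h1 : 1 ≤ i) (h2 : i < n) :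
    adjT n i ⟨i - 1, by omega⟩ = ⟨i, h2⟩ := by
  rw [adjT_of_mem h1 h2, Equiv.swap_apply_left]

theorem leftStabilizerIndices_youngProduct {n : ℕ} {M N : Set ℕ} (hM : M ⊆ Set.Ico 1 n)
    (h : Linked M N) : leftStabilizerIndices n (youngProduct n M N) = M := by
  refine Set.Subset.antisymm ?_ fun i hi =>
    inter_Ico_subset_leftStabilizerIndices n M N ⟨hi, hM hi⟩
  rintro i ⟨⟨h1, h2⟩, hi⟩
  by_contra hiM
  have key : ∀ x ∈ youngSubgroup n M, ∃ u ∈ youngSubgroup n M, ∃ v ∈ youngSubgroup n N,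
      adjT n i * x = u * v := fun x hx => hi x ⟨x, hx, 1, one_mem _, by simp⟩
  have hiN : i ∈ N := by
    by_contra hiN
    obtain ⟨u, hu, v, hv, he⟩ := key 1 (one_mem _)
    have e := congrArg (fun w : Equiv.Perm (Fin n) => (w ⟨i, h2⟩ : ℕ)) he
    simp only [mul_one, adjT_apply_self h1 h2, Equiv.Perm.mul_apply] at e
    have := youngSubgroup_val_lt_iff hiM hu (v ⟨i, h2⟩)
    have := youngSubgroup_val_lt_iff hiN hv ⟨i, h2⟩
    simp only at this
    omega
  obtain ⟨j, ⟨hjM, hjN⟩, hb⟩ := h i ⟨hiN, hiM⟩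
  have hj := hM hjM
  have hj1 := hj.1
  have hj2 := hj.2
  rcases lt_trichotomy i j with hij | rfl | hij
  · have hx := swap_mem_youngSubgroup (n := n) (I := M) i j hij.le hj.2 (by
      intro k hk1 hk2
      rcases hk2.lt_or_eq with hk | rfl
      · exact (hb k (Or.inl ⟨hk1, hk⟩)).1
      · exact hjM)
    obtain ⟨u, hu, v, hv, he⟩ := key _ hx
    have e := congrArg (fun w : Equiv.Perm (Fin n) => (w ⟨j, hj.2⟩ : ℕ)) he
    simp only [Equiv.Perm.mul_apply, Equiv.swap_apply_right, adjT_apply_self h1 h2] at e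
    have := youngSubgroup_val_lt_iff hiM hu (v ⟨j, hj.2⟩)
    have := youngSubgroup_val_lt_iff hjN hv ⟨j, hj.2⟩
    simp only at this
    omega
  · exact hjN hiN
  · have hx := swap_mem_youngSubgroup (n := n) (I := M) (j - 1) (i - 1) (by omega) (by omega) (by
      intro k hk1 hk2
      rcases (show j ≤ k by omega).lt_or_eq with hk | rfl
      · exact (hb k (Or.inr ⟨hk, by omega⟩)).1
      · exact hjM)
    obtain ⟨u, hu, v, hv, he⟩ := key _ hx
    have e := congrArg (fun w : Equiv.Perm (Fin n) => (w ⟨j - 1, by omega⟩ : ℕ)) he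
    simp only [Equiv.Perm.mul_apply, Equiv.swap_apply_left, adjT_apply_pred h1 h2] at e
    have := youngSubgroup_val_lt_iff hiM hu (v ⟨j - 1, by omega⟩)
    have := youngSubgroup_val_lt_iff hjN hv ⟨j - 1, by omega⟩
    simp only at this
    omega

/-- If the connected component `K` of `i` in `M ∪ {i}` is contained in `N`, then left
multiplication by `s_i` preserves `W_M ⬝ W_N`. -/
theorem adjT_mul_mem_youngProduct {n i : ℕ} {M N : Set ℕ} (hiN : i ∈ N)
    (hK : ∀ j, (∀ k, (i < k ∧ k ≤ j) ∨ (j ≤ k ∧ k < i) → k ∈ M) → j ∈ N)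
    {x : Equiv.Perm (Fin n)} (hx : x ∈ youngProduct n M N) :
    adjT n i * x ∈ youngProduct n M N := by
  set K : Set ℕ := {j | ∀ k, (i < k ∧ k ≤ j) ∨ (j ≤ k ∧ k < i) → k ∈ M}
  have hKN : K ⊆ N := hK
  have hiK : i ∈ K := fun k hk => by omega
  have hcomm : ∀ j ∈ M, j ∉ K → ∀ k ∈ K, Commute (adjT n j) (adjT n k) := by
    intro j hjM hjK k hk
    apply adjT_commute
    by_contra hc
    apply hjK
    intro t ht
    by_cases hkt : (i < t ∧ t ≤ k) ∨ (k ≤ t ∧ t < i)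
    · exact hk t hkt
    · obtain rfl : t = j := by omega
      exact hjM
  have hdec : ∀ u ∈ youngSubgroup n M, ∃ u₁ ∈ youngSubgroup n M, ∃ u₂ ∈ youngSubgroup n K,
      Commute (adjT n i) u₁ ∧ u = u₁ * u₂ := by
    intro u hu
    refine youngSubgroup_induction (p := fun u => ∃ u₁ ∈ youngSubgroup n M,
      ∃ u₂ ∈ youngSubgroup n K, Commute (adjT n i) u₁ ∧ u = u₁ * u₂)
      ⟨1, one_mem _, 1, one_mem _, Commute.one_right _, by simp⟩ ?_ hu
    rintro _ j hjM ⟨u₁, hu₁, u₂, hu₂, hc, rfl⟩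
    by_cases hjK : j ∈ K
    · exact ⟨u₁, hu₁, u₂ * adjT n j, mul_mem hu₂ (adjT_mem_youngSubgroup hjK), hc,
        mul_assoc _ _ _⟩
    · have hcu : Commute (adjT n j) u₂ :=
        youngSubgroup_induction (p := fun w => Commute (adjT n j) w) (Commute.one_right _)
          (fun w k hk hw => hw.mul_right (hcomm j hjM hjK k hk)) hu₂
      exact ⟨u₁ * adjT n j, mul_mem hu₁ (adjT_mem_youngSubgroup hjM), u₂, hu₂,
        hc.mul_right (hcomm j hjM hjK i hiK).symm, by rw [mul_assoc, mul_assoc, hcu.eq]⟩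
  obtain ⟨u, hu, v, hv, rfl⟩ := hx
  obtain ⟨u₁, hu₁, u₂, hu₂, hc, rfl⟩ := hdec u hu
  refine ⟨u₁, hu₁, adjT n i * u₂ * v,
    mul_mem (mul_mem (adjT_mem_youngSubgroup hiN) (youngSubgroup_mono hKN hu₂)) hv, ?_⟩
  rw [← mul_assoc, ← mul_assoc, hc.eq]
  simp only [mul_assoc]

theorem linked_of_leftStabilizerIndices_subset {n : ℕ} {M N : Set ℕ} (hN : N ⊆ Set.Ico 1 n)
    (h : leftStabilizerIndices n (youngProduct n M N) ⊆ M) : Linked M N := by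
  rintro i ⟨hiN, hiM⟩
  by_contra! hc
  refine hiM (h ⟨hN hiN, fun x hx => adjT_mul_mem_youngProduct hiN ?_ hx⟩)
  have main : ∀ d j, j ≤ i + d → i ≤ j + d →
      (∀ k, (i < k ∧ k ≤ j) ∨ (j ≤ k ∧ k < i) → k ∈ M) → j ∈ N := by
    intro d
    induction d with
    | zero =>
      intro j h1 h2 _
      obtain rfl : j = i := by omega
      exact hiN
    | succ d ih =>
      intro j h1 h2 hj
      by_contra hjN
      have hji : j ≠ i := fun e => hjN (e ▸ hiN)
      obtain ⟨k, hk, hk'⟩ := hc j ⟨hj j (by omega), hjN⟩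
      refine hk' ⟨hj k (by omega), ih k (by omega) (by omega) fun t ht => hj t (by omega)⟩
  exact fun j => main (i + j) j (by omega) (by omega)

theorem mul_mem_of_mem_youngSubgroup_leftStabilizerIndices {n : ℕ}
    {C : Set (Equiv.Perm (Fin n))} {u : Equiv.Perm (Fin n)}
    (hu : u ∈ youngSubgroup n (leftStabilizerIndices n C)) {x : Equiv.Perm (Fin n)}
    (hx : x ∈ C) : u * x ∈ C := by
  revert x
  refine youngSubgroup_induction (p := fun u => ∀ {x}, x ∈ C → u * x ∈ C) (by simp) ?_ hu
  intro u i hi hu x hx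
  rw [mul_assoc]
  exact hu (hi.2 x hx)

theorem youngProduct_leftStabilizerIndices (n : ℕ) (I J : Set ℕ) :
    youngProduct n (leftStabilizerIndices n (youngProduct n I J))
      (leftStabilizerIndices n (youngProduct n J I)) = youngProduct n I J := by
  apply Set.Subset.antisymm
  · rintro _ ⟨u, hu, v, hv, rfl⟩
    apply mul_mem_of_mem_youngSubgroup_leftStabilizerIndices hu
    rw [← inv_youngProduct, Set.mem_inv]
    have h1 : (1 : Equiv.Perm (Fin n)) ∈ youngProduct n J I :=
      ⟨1, one_mem _, 1, one_mem _, by simp⟩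
    simpa using mul_mem_of_mem_youngSubgroup_leftStabilizerIndices (inv_mem hv) h1
  · rintro _ ⟨u, hu, v, hv, rfl⟩
    exact ⟨u, youngSubgroup_le_of_inter (inter_Ico_subset_leftStabilizerIndices n I J) hu,
      v, youngSubgroup_le_of_inter (inter_Ico_subset_leftStabilizerIndices n J I) hv, rfl⟩

/-- The pairs of subsets of `{1, …, n - 1}` that are the maximal `(I, J)` with a given
`W_I ⬝ W_J`. -/
def maximalPairs (n : ℕ) : Set (Set ℕ × Set ℕ) :=
  {p | p.1 ⊆ Set.Ico 1 n ∧ p.2 ⊆ Set.Ico 1 n ∧ Linked p.1 p.2 ∧ Linked p.2 p.1}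

theorem image_youngProduct_maximalPairs (n : ℕ) :
    (fun p : Set ℕ × Set ℕ => youngProduct n p.1 p.2) '' maximalPairs n =
      identityDoubleCosets n := by
  apply Set.Subset.antisymm
  · rintro _ ⟨p, _, rfl⟩
    exact ⟨p.1, p.2, rfl⟩
  · rintro _ ⟨I, J, rfl⟩
    have h := youngProduct_leftStabilizerIndices n I J
    have h' := youngProduct_leftStabilizerIndices n J I
    have hsub (C) : leftStabilizerIndices n C ⊆ Set.Ico 1 n := fun _ h => h.1
    exact ⟨⟨leftStabilizerIndices n (youngProduct n I J),
      leftStabilizerIndices n (youngProduct n J I)⟩, ⟨hsub _, hsub _,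
      linked_of_leftStabilizerIndices_subset (hsub _) (by rw [h]),
      linked_of_leftStabilizerIndices_subset (hsub _) (by rw [h'])⟩, h⟩

theorem injOn_youngProduct_maximalPairs (n : ℕ) :
    Set.InjOn (fun p : Set ℕ × Set ℕ => youngProduct n p.1 p.2) (maximalPairs n) := by
  rintro ⟨M, N⟩ ⟨hM, hN, h, h'⟩ ⟨M', N'⟩ ⟨hM', hN', k, k'⟩ he
  simp only at he hM hN h h' hM' hN' k k'
  have he' : youngProduct n N M = youngProduct n N' M' := by
    rw [← inv_youngProduct, he, inv_youngProduct]
  refine Prod.ext ?_ ?_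
  · exact (leftStabilizerIndices_youngProduct hM h).symm.trans
      (he ▸ leftStabilizerIndices_youngProduct hM' k)
  · exact (leftStabilizerIndices_youngProduct hN h').symm.trans
      (he' ▸ leftStabilizerIndices_youngProduct hN' k')

theorem dSeq_eq_ncard_maximalPairs (n : ℕ) : dSeq n = (maximalPairs n).ncard := by
  rw [dSeq, ← image_youngProduct_maximalPairs,
    (injOn_youngProduct_maximalPairs n).ncard_image]

/-- The first letter of the word other than `(true, true)` exists and is `x`. -/
def NextIs (x : Bool × Bool) : List (Bool × Bool) → Prop
  | [] => False
  | y :: l => y = x ∨ (y = (true, true) ∧ NextIs x l)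

/-- The word encodes a continuation of a pair of linked sets. The propositions `p` and `q` say
that the last letter other than `(true, true)` before the word is `(true, false)`,
respectively `(false, true)`. -/
def LinkedWord : Prop → Prop → List (Bool × Bool) → Prop
  | _, _, [] => True
  | p, q, y :: l =>
    (y = (false, true) → p ∨ NextIs (true, false) l) ∧
    (y = (true, false) → q ∨ NextIs (false, true) l) ∧
    LinkedWord (y = (true, false) ∨ (y = (true, true) ∧ p))
      (y = (false, true) ∨ (y = (true, true) ∧ q)) l

/-- The last letter of `f 0, …, f (a - 1)` other than `(true, true)` exists and is `x`. -/
def PrevIs (x : Bool × Bool) (f : ℕ → Bool × Bool) (a : ℕ) : Prop :=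
  ∃ j, j < a ∧ f j = x ∧ ∀ k, j < k → k < a → f k = (true, true)

theorem prevIs_succ (x : Bool × Bool) (f : ℕ → Bool × Bool) (a : ℕ) :
    PrevIs x f (a + 1) ↔ f a = x ∨ (f a = (true, true) ∧ PrevIs x f a) := by
  constructor
  · rintro ⟨j, hj, hx, h⟩
    rcases (Nat.lt_succ_iff.1 hj).lt_or_eq with hj' | rfl
    · exact Or.inr ⟨h a hj' (by omega), j, hj', hx, fun k h1 h2 => h k h1 (by omega)⟩
    · exact Or.inl hx
  · rintro (hx | ⟨ha, j, hj, hx, h⟩)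
    · exact ⟨a, by omega, hx, fun k h1 h2 => by omega⟩
    · refine ⟨j, by omega, hx, fun k h1 h2 => ?_⟩
      rcases (Nat.lt_succ_iff.1 h2).lt_or_eq with hk | rfl
      · exact h k h1 hk
      · exact ha

theorem nextIs_map_range' (x : Bool × Bool) (f : ℕ → Bool × Bool) (d a : ℕ) :
    NextIs x ((List.range' a d).map f) ↔
      ∃ j, a ≤ j ∧ j < a + d ∧ f j = x ∧ ∀ k, a ≤ k → k < j → f k = (true, true) := by
  induction d generalizing a with
  | zero =>
    simp only [List.range'_zero, List.map_nil, NextIs, false_iff]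
    rintro ⟨j, h1, h2, -⟩
    omega
  | succ d ih =>
    rw [List.range'_succ, List.map_cons, NextIs, ih]
    constructor
    · rintro (hx | ⟨ha, j, h1, h2, hx, h⟩)
      · exact ⟨a, le_rfl, by omega, hx, fun k h1 h2 => by omega⟩
      · refine ⟨j, by omega, by omega, hx, fun k h3 h4 => ?_⟩
        rcases h3.lt_or_eq with hk | rfl
        · exact h k hk h4
        · exact ha
    · rintro ⟨j, h1, h2, hx, h⟩
      rcases h1.lt_or_eq with hj | rfl
      · exact Or.inr ⟨h a le_rfl hj, j, hj, by omega, hx, fun k h3 h4 => h k (by omega) h4⟩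
      · exact Or.inl hx

theorem linkedWord_map_range' (f : ℕ → Bool × Bool) (d a : ℕ) :
    LinkedWord (PrevIs (true, false) f a) (PrevIs (false, true) f a)
        ((List.range' a d).map f) ↔
      ∀ i, a ≤ i → i < a + d →
        (f i = (false, true) → PrevIs (true, false) f i ∨
          ∃ j, i + 1 ≤ j ∧ j < a + d ∧ f j = (true, false) ∧
            ∀ k, i + 1 ≤ k → k < j → f k = (true, true)) ∧
        (f i = (true, false) → PrevIs (false, true) f i ∨
          ∃ j, i + 1 ≤ j ∧ j < a + d ∧ f j = (false, true) ∧
            ∀ k, i + 1 ≤ k → k < j → f k = (true, true)) := by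
  induction d generalizing a with
  | zero =>
    simp only [List.range'_zero, List.map_nil, LinkedWord, true_iff]
    intro i h1 h2
    omega
  | succ d ih =>
    rw [List.range'_succ, List.map_cons, LinkedWord, ← prevIs_succ, ← prevIs_succ, ih,
      nextIs_map_range', nextIs_map_range', show a + 1 + d = a + (d + 1) by omega]
    constructor
    · rintro ⟨h1, h2, h⟩ i hi hi'
      rcases hi.lt_or_eq with hi | rfl
      · exact h i hi hi'
      · exact ⟨h1, h2⟩
    · intro h
      exact ⟨(h a le_rfl (by omega)).1, (h a le_rfl (by omega)).2,
        fun i hi hi' => h i (by omega) hi'⟩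

open Classical in
/-- The word of length `k` recording which of the two sets contain `1, …, k`. -/
noncomputable def pairWord (k : ℕ) (p : Set ℕ × Set ℕ) : List (Bool × Bool) :=
  (List.range' 1 k).map fun i => (decide (i ∈ p.1), decide (i ∈ p.2))

theorem linkedWord_pairWord {k : ℕ} {p : Set ℕ × Set ℕ} (h1 : p.1 ⊆ Set.Ico 1 (k + 1))
    (h2 : p.2 ⊆ Set.Ico 1 (k + 1)) :
    LinkedWord False False (pairWord k p) ↔ Linked p.1 p.2 ∧ Linked p.2 p.1 := by
  classical
  obtain ⟨M, N⟩ := p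
  simp only at h1 h2
  set f : ℕ → Bool × Bool := fun i => (decide (i ∈ M), decide (i ∈ N)) with hf
  have hb (i) : f i = (true, true) ↔ i ∈ M ∧ i ∈ N := by simp [hf]
  have hm (i) : f i = (true, false) ↔ i ∈ M ∧ i ∉ N := by simp [hf]
  have hn (i) : f i = (false, true) ↔ i ∈ N ∧ i ∉ M := by simp [hf, and_comm]
  have hM0 : 0 ∉ M := fun h => by simpa using (h1 h).1
  have hN0 : 0 ∉ N := fun h => by simpa using (h2 h).1
  have e1 : PrevIs (true, false) f 1 = False := by
    simp [PrevIs, hm, hM0]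
  have e2 : PrevIs (false, true) f 1 = False := by
    simp [PrevIs, hn, hN0]
  have key := linkedWord_map_range' f k 1
  rw [e1, e2] at key
  rw [show pairWord k (M, N) = (List.range' 1 k).map f from rfl, key]
  simp only [PrevIs, hb, hm, hn]
  constructor
  · intro h
    constructor
    · rintro i ⟨hi, hi'⟩
      obtain ⟨j, _, hj, hk⟩ | ⟨j, _, _, hj, hk⟩ :=
        (h i (h2 hi).1 (by have := (h2 hi).2; omega)).1 ⟨hi, hi'⟩
      · exact ⟨j, hj, fun t ht => hk t (by omega) (by omega)⟩
      · exact ⟨j, hj, fun t ht => hk t (by omega) (by omega)⟩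
    · rintro i ⟨hi, hi'⟩
      obtain ⟨j, _, hj, hk⟩ | ⟨j, _, _, hj, hk⟩ :=
        (h i (h1 hi).1 (by have := (h1 hi).2; omega)).2 ⟨hi, hi'⟩
      · exact ⟨j, hj, fun t ht => (hk t (by omega) (by omega)).symm⟩
      · exact ⟨j, hj, fun t ht => (hk t (by omega) (by omega)).symm⟩
  · rintro ⟨h, h'⟩ i _ _
    constructor
    · intro hi
      obtain ⟨j, hj, hk⟩ := h i hi
      have := (h1 hj.1).2
      rcases lt_trichotomy i j with hij | rfl | hij
      · exact Or.inr ⟨j, hij, by omega, hj, fun t _ _ => hk t (by omega)⟩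
      · exact absurd hi.1 hj.2
      · exact Or.inl ⟨j, hij, hj, fun t _ _ => hk t (by omega)⟩
    · intro hi
      obtain ⟨j, hj, hk⟩ := h' i hi
      have := (h2 hj.1).2
      rcases lt_trichotomy i j with hij | rfl | hij
      · exact Or.inr ⟨j, hij, by omega, hj, fun t _ _ => (hk t (by omega)).symm⟩
      · exact absurd hi.1 hj.2
      · exact Or.inl ⟨j, hij, hj, fun t _ _ => (hk t (by omega)).symm⟩

theorem bijOn_pairWord (k : ℕ) :
    Set.BijOn (pairWord k) (maximalPairs (k + 1))
      {l | l.length = k ∧ LinkedWord False False l} := by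
  refine ⟨?_, ?_, ?_⟩
  · rintro p ⟨h1, h2, h⟩
    exact ⟨by simp [pairWord], (linkedWord_pairWord h1 h2).2 h⟩
  · rintro p ⟨h1, h2, -⟩ p' ⟨h1', h2', -⟩ he
    have he' : ∀ i ∈ Set.Ico 1 (k + 1), (i ∈ p.1 ↔ i ∈ p'.1) ∧ (i ∈ p.2 ↔ i ∈ p'.2) := by
      intro i hi
      have := List.map_inj_left.1 he i (by
        rw [List.mem_range'_1]; exact ⟨hi.1, by have := hi.2; omega⟩)
      simpa using this
    refine Prod.ext (Set.ext fun i => ?_) (Set.ext fun i => ?_)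
    · exact ⟨fun h => (he' i (h1 h)).1.1 h, fun h => (he' i (h1' h)).1.2 h⟩
    · exact ⟨fun h => (he' i (h2 h)).2.1 h, fun h => (he' i (h2' h)).2.2 h⟩
  · rintro l ⟨hl, h⟩
    let p : Set ℕ × Set ℕ :=
      ({i | 1 ≤ i ∧ (l.getD (i - 1) (false, false)).1 = true},
        {i | 1 ≤ i ∧ (l.getD (i - 1) (false, false)).2 = true})
    have hw : pairWord k p = l := by
      apply List.ext_getElem
      · simp [pairWord, hl]
      · intro i h1 h2
        simp [pairWord, p, h2]
    have hlt : ∀ i, 1 ≤ i → l.getD (i - 1) (false, false) ≠ (false, false) →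
        i ∈ Set.Ico 1 (k + 1) := by
      intro i hi hne
      refine ⟨hi, ?_⟩
      by_contra hc
      exact hne (List.getD_eq_default _ _ (by omega))
    have h1 : p.1 ⊆ Set.Ico 1 (k + 1) := fun i hi =>
      hlt i hi.1 fun e => by
      have := hi.2
      rw [e] at this
      cases this
    have h2 : p.2 ⊆ Set.Ico 1 (k + 1) := fun i hi =>
      hlt i hi.1 fun e => by
      have := hi.2
      rw [e] at this
      cases this
    exact ⟨p, ⟨h1, h2, (linkedWord_pairWord h1 h2).1 (hw ▸ h)⟩, hw⟩

/-- The number of words of length `k` satisfying `P`. -/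
noncomputable def wordCount (P : List (Bool × Bool) → Prop) (k : ℕ) : ℕ :=
  Nat.card {l : List (Bool × Bool) // l.length = k ∧ P l}

theorem wordCount_zero_of_pos {P : List (Bool × Bool) → Prop} (h : P []) :
    wordCount P 0 = 1 := by
  have (l : List (Bool × Bool)) : l.length = 0 ∧ P l ↔ l = [] := by
    rw [List.length_eq_zero_iff]
    exact and_iff_left_of_imp fun hl => hl ▸ h
  simp only [wordCount, this]
  simp

theorem wordCount_zero_of_neg {P : List (Bool × Bool) → Prop} (h : ¬ P []) :
    wordCount P 0 = 0 := by
  have (l : List (Bool × Bool)) : ¬ (l.length = 0 ∧ P l) := by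
    rw [List.length_eq_zero_iff]
    rintro ⟨rfl, hl⟩
    exact h hl
  simp only [wordCount, this]
  simp

theorem wordCount_succ (P : List (Bool × Bool) → Prop) (k : ℕ) :
    wordCount P (k + 1) =
      wordCount (fun l => P ((true, true) :: l)) k +
      wordCount (fun l => P ((true, false) :: l)) k +
      (wordCount (fun l => P ((false, true) :: l)) k +
      wordCount (fun l => P ((false, false) :: l)) k) := by
  have (y : Bool × Bool) : Finite {l : List (Bool × Bool) // l.length = k ∧ P (y :: l)} :=
    ((List.finite_length_eq (Bool × Bool) k).subset fun l hl => hl.1).to_subtype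
  let e : {l : List (Bool × Bool) // l.length = k + 1 ∧ P l} ≃
      Σ y : Bool × Bool, {l : List (Bool × Bool) // l.length = k ∧ P (y :: l)} :=
    { toFun := fun
        | ⟨[], h⟩ => absurd h.1 (by simp)
        | ⟨y :: l, h⟩ => ⟨y, l, by simpa using h.1, h.2⟩
      invFun := fun x => ⟨x.1 :: x.2.1, by simp [x.2.2.1], x.2.2.2⟩
      left_inv := by
        rintro ⟨_ | ⟨y, l⟩, h⟩
        · simp at h
        · rfl
      right_inv := fun _ => rfl }
  rw [wordCount, Nat.card_congr e, Nat.card_sigma, Fintype.sum_prod_type]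
  simp [wordCount]

theorem wordCount_false (k : ℕ) : wordCount (fun _ => False) k = 0 := by
  simp [wordCount]

theorem dSeq_succ (k : ℕ) : dSeq (k + 1) = wordCount (LinkedWord False False) k := by
  rw [dSeq_eq_ncard_maximalPairs, ← (bijOn_pairWord k).injOn.ncard_image,
    (bijOn_pairWord k).image_eq]
  rfl

/-- The numbers `d_n` satisfy a first-order linear system; the auxiliary sequences count words
that continue a block of nonempty letters. -/
theorem exists_linear_system : ∃ t p : ℕ → ℕ, dSeq 1 = 1 ∧ t 0 = 2 ∧ p 0 = 0 ∧
    ∀ k, dSeq (k + 2) = 2 * dSeq (k + 1) + p k ∧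
      t (k + 1) = 2 * dSeq (k + 1) + 2 * t k + p k ∧ p (k + 1) = p k + t k := by
  refine ⟨fun k => wordCount (LinkedWord True False) k + wordCount (LinkedWord False True) k,
    fun k => wordCount (fun l => NextIs (false, true) l ∧ LinkedWord True False l) k +
      wordCount (fun l => NextIs (true, false) l ∧ LinkedWord False True l) k, ?_, ?_, ?_, ?_⟩
  · rw [dSeq_succ 0, wordCount_zero_of_pos trivial]
  · simp only [wordCount_zero_of_pos (P := LinkedWord _ _) trivial]
  · simp only [wordCount_zero_of_neg (P := fun l => NextIs _ l ∧ LinkedWord _ _ l) fun h => h.1]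
  · intro k
    simp only [dSeq_succ, wordCount_succ]
    simp only [LinkedWord, NextIs, Prod.mk.injEq, Bool.true_eq_false, Bool.false_eq_true, and_true,
      true_and, and_self, and_false, false_and, or_false, false_or, or_true, true_or, or_self,
      imp_self, true_implies, false_implies, wordCount_false]
    refine ⟨?_, ?_, ?_⟩ <;> ring

/-- The number `d_n` of parabolic double cosets of `S_n` with minimal element the
identity satisfies `d_1 = 1`, `d_2 = 2`, `d_3 = 6`, and
`d_n = 5 d_{n-1} - 7 d_{n-2} + 4 d_{n-3}` for `n ≥ 4` (so `d_4 = 20`, `d_5 = 66`). -/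
theorem identity_double_coset_recurrence :
    dSeq 1 = 1 ∧ dSeq 2 = 2 ∧ dSeq 3 = 6 ∧
    (∀ n : ℕ, 4 ≤ n →
      (dSeq n : ℤ) = 5 * dSeq (n - 1) - 7 * dSeq (n - 2) + 4 * dSeq (n - 3)) ∧
    dSeq 4 = 20 ∧ dSeq 5 = 66 := by
  obtain ⟨t, p, hd, ht, hp, h⟩ := exists_linear_system
  have h0 := h 0
  have h1 := h 1
  have h2 := h 2
  have h3 := h 3
  norm_num at h0 h1 h2 h3
  refine ⟨hd, by omega, by omega, ?_, by omega, by omega⟩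
  intro n hn
  obtain ⟨k, rfl⟩ := Nat.exists_eq_add_of_le' hn
  have h1 := h k
  have h2 := h (k + 1)
  have h3 := h (k + 2)
  simp only [show k + 4 - 1 = k + 3 by omega, show k + 4 - 2 = k + 2 by omega,
    show k + 4 - 3 = k + 1 by omega, add_assoc, Nat.reduceAdd] at h1 h2 h3 ⊢
  omega
end
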